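/- arXiv:1811.00593 — 3 statements merged into one kernel-verified Lean document; each statement's English description precedes it below -/
import Mathlib

section
/- Fix n ≥ 1 and suppose μ_P has finite moments μ^{(i)} := ∫ y^i dμ_P(y) < ∞ for i = 1,…,n. Define d_i := ∫_0^1 M_r(u)^i/u du for i ≥ 1 (these are finite since M_r is bounded and d_1 < ∞). Then the n-th moment of g_r is finite and satisfies ∫ x^n dg_r(x) = Σ_{k=1}^n (λ/H_r)^k · B_{n,k}( μ^{(1)} d_1, μ^{(2)} d_2, …, μ^{(n−k+1)} d_{n−k+1} ), where B_{n,k}(x_1,…,x_{n−k+1}) := Σ n!/(j_1!·j_2!⋯j_{n−k+1}!) · ∏_{i=1}^{n−k+1} (x_i/i!)^{j_i} is the partial Bell polynomial, the sum being over all nonnegative integers j_1,…,j_{n−k+1} with Σ_i j_i = k and Σ_i i·j_i = n. -/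
open MeasureTheory Filter Topology

noncomputable section

/-- The partial Bell polynomial
`B_{n,k}(x_1,…,x_{n−k+1}) = Σ n!/(j_1!⋯j_{n−k+1}!) · ∏_i (x_i/i!)^{j_i}`,
the sum running over all nonnegative integers `j_1,…,j_{n−k+1}` with
`Σ_i j_i = k` and `Σ_i i·j_i = n` (such `j_i` are necessarily `≤ n`,
so we may index them by `Fin (n+1)`). -/
def bellPoly (n k : ℕ) (x : ℕ → ℝ) : ℝ :=
  ∑ j ∈ Finset.filter
      (fun j : Fin (n - k + 1) → Fin (n + 1) =>
        (∑ i : Fin (n - k + 1), (j i : ℕ)) = k ∧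
          (∑ i : Fin (n - k + 1), ((i : ℕ) + 1) * (j i : ℕ)) = n)
      Finset.univ,
    (n.factorial : ℝ) / (∏ i : Fin (n - k + 1), ((j i : ℕ).factorial : ℝ)) *
      ∏ i : Fin (n - k + 1), (x ((i : ℕ) + 1) / (((i : ℕ) + 1).factorial : ℝ)) ^ (j i : ℕ)

namespace OutletMoment

/-- Shifted exponential generating series: coefficient `x (i+1)/(i+1)!`. -/
def G (x : ℕ → ℝ) : PowerSeries ℝ :=
  PowerSeries.mk fun i => x (i + 1) / ((i + 1).factorial : ℝ)

def F (x : ℕ → ℝ) : PowerSeries ℝ := PowerSeries.X * G x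

/-- truncation of `G` -/
def GN (x : ℕ → ℝ) (N : ℕ) : PowerSeries ℝ :=
  ∑ i : Fin N, PowerSeries.monomial (i : ℕ) (x ((i : ℕ) + 1) / (((i : ℕ) + 1).factorial : ℝ))

lemma coeff_G_pow_eq (x : ℕ → ℝ) (N d k : ℕ) (h : d < N) :
    PowerSeries.coeff d (G x ^ k) = PowerSeries.coeff d (GN x N ^ k) := by
  have h1 : (PowerSeries.X : PowerSeries ℝ) ^ N ∣ G x - GN x N := by
    rw [PowerSeries.X_pow_dvd_iff]
    intro m hm
    simp only [G, GN, map_sub, map_sum, PowerSeries.coeff_mk, PowerSeries.coeff_monomial]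
    rw [Finset.sum_eq_single (⟨m, hm⟩ : Fin N)]
    · simp
    · intro b _ hb
      rw [if_neg]
      intro h
      exact hb (Fin.ext h.symm)
    · simp
  have h2 := h1.trans (sub_dvd_pow_sub_pow (G x) (GN x N) k)
  have h3 := PowerSeries.X_pow_dvd_iff.1 h2 d h
  rw [map_sub, sub_eq_zero] at h3
  exact h3

lemma prod_monomial {ι : Type*} (s : Finset ι) (e : ι → ℕ) (a : ι → ℝ) :
    ∏ i ∈ s, PowerSeries.monomial (e i) (a i) =
      PowerSeries.monomial (∑ i ∈ s, e i) (∏ i ∈ s, a i) := by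
  classical
  induction s using Finset.induction_on with
  | empty => simp
  | insert b s hb ih =>
    rw [Finset.prod_insert hb, Finset.sum_insert hb, Finset.prod_insert hb, ih,
      PowerSeries.monomial_mul_monomial]

lemma bell_eq (n k : ℕ) (hk : k ≤ n) (x : ℕ → ℝ) :
    bellPoly n k x = (n.factorial : ℝ) * (PowerSeries.coeff n (F x ^ k) / (k.factorial : ℝ)) := by
  have e1 : PowerSeries.coeff n (F x ^ k) = PowerSeries.coeff (n - k) (GN x (n - k + 1) ^ k) := by
    rw [← coeff_G_pow_eq x (n - k + 1) (n - k) k (Nat.lt_succ_self _), F, mul_pow]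
    conv_lhs => rw [show n = (n - k) + k by omega]
    rw [PowerSeries.coeff_X_pow_mul]
  rw [e1, GN, Finset.sum_pow_eq_sum_piAntidiag, map_sum, Finset.sum_div, Finset.mul_sum, bellPoly]
  have e2 : ∀ j ∈ Finset.piAntidiag (Finset.univ : Finset (Fin (n - k + 1))) k,
      (n.factorial : ℝ) * (PowerSeries.coeff (n - k)
        ((Nat.multinomial Finset.univ j : PowerSeries ℝ) * ∏ i : Fin (n - k + 1),
          (PowerSeries.monomial (i : ℕ)
            (x ((i : ℕ) + 1) / (((i : ℕ) + 1).factorial : ℝ))) ^ j i) / (k.factorial : ℝ)) =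
      if (∑ i : Fin (n - k + 1), ((i : ℕ) + 1) * j i) = n then
        (n.factorial : ℝ) / (∏ i : Fin (n - k + 1), ((j i).factorial : ℝ)) *
      ∏ i : Fin (n - k + 1), (x ((i : ℕ) + 1) / (((i : ℕ) + 1).factorial : ℝ)) ^ (j i)
      else 0 := by
    intro j hj
    have hs : ∑ i, j i = k := (Finset.mem_piAntidiag.1 hj).1
    simp_rw [PowerSeries.monomial_pow, prod_monomial]
    have hm := Nat.multinomial_spec Finset.univ j
    rw [hs] at hm
    have hm' : (∏ i, ((j i).factorial : ℝ)) * (Nat.multinomial Finset.univ j : ℝ)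
        = (k.factorial : ℝ) := by exact_mod_cast hm
    have hp : (∏ i, ((j i).factorial : ℝ)) ≠ 0 :=
      Finset.prod_ne_zero_iff.2 fun i _ => by positivity
    have hkf : (k.factorial : ℝ) ≠ 0 := by positivity
    have hc : PowerSeries.coeff (n - k) ((Nat.multinomial Finset.univ j : PowerSeries ℝ) *
        PowerSeries.monomial (∑ i : Fin (n - k + 1), j i * (i : ℕ))
          (∏ i : Fin (n - k + 1), (x ((i : ℕ) + 1) / (((i : ℕ) + 1).factorial : ℝ)) ^ (j i)))
        = (Nat.multinomial Finset.univ j : ℝ) *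
        if n - k = ∑ i : Fin (n - k + 1), j i * (i : ℕ) then
          (∏ i : Fin (n - k + 1), (x ((i : ℕ) + 1) / (((i : ℕ) + 1).factorial : ℝ)) ^ (j i))
          else 0 := by
      rw [← nsmul_eq_mul, map_nsmul, PowerSeries.coeff_monomial, nsmul_eq_mul]
    rw [hc]
    have hsum : ∑ i : Fin (n - k + 1), ((i : ℕ) + 1) * j i
        = (∑ i : Fin (n - k + 1), j i * (i : ℕ)) + k := by
      refine Eq.trans ?_ (congrArg (fun z => (∑ i : Fin (n - k + 1), j i * (i : ℕ)) + z) hs)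
      rw [← Finset.sum_add_distrib]
      exact Finset.sum_congr rfl fun i _ => by ring
    by_cases hcond : n - k = ∑ i : Fin (n - k + 1), j i * (i : ℕ)
    · rw [if_pos hcond, if_pos (by omega), ← hm']
      rw [← hm'] at hkf
      have := right_ne_zero_of_mul hkf
      field_simp
    · rw [if_neg hcond, if_neg (by omega)]
      simp
  rw [Finset.sum_congr rfl e2, ← Finset.sum_filter]
  refine Finset.sum_bij' (fun j _ i => (j i : ℕ))
    (fun j hj i => (⟨j i, by
      have hj' := (Finset.mem_piAntidiag.1 (Finset.mem_filter.1 hj).1).1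
      have := Finset.single_le_sum (f := j) (fun i _ => Nat.zero_le _) (Finset.mem_univ i)
      exact Nat.lt_succ_of_le ((this.trans hj'.le).trans hk)⟩ : Fin (n + 1))) ?_ ?_ ?_ ?_ ?_
  · intro j hj
    simpa using hj
  · intro j hj
    simpa using hj
  · intro j hj
    rfl
  · intro j hj
    rfl
  · intro j hj
    rfl

lemma coeff_F_pow_zero (x : ℕ → ℝ) (n k : ℕ) (h : n < k) :
    PowerSeries.coeff n (F x ^ k) = 0 := by
  rw [F, mul_pow, PowerSeries.coeff_X_pow_mul', if_neg (by omega)]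

/-- complete Bell numbers divided by `n!` -/
def a (x : ℕ → ℝ) (n : ℕ) : ℝ :=
  ∑ k ∈ Finset.range (n + 1), PowerSeries.coeff n (F x ^ k) / (k.factorial : ℝ)

lemma a_eq (x : ℕ → ℝ) (n N : ℕ) (h : n < N) :
    a x n = ∑ k ∈ Finset.range N, PowerSeries.coeff n (F x ^ k) / (k.factorial : ℝ) := by
  rw [a]
  apply Finset.sum_subset
  · intro k hk
    simp only [Finset.mem_range] at *
    omega
  · intro k _ hk
    simp only [Finset.mem_range] at hk
    rw [coeff_F_pow_zero x n k (by omega), zero_div]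

lemma a_rec (x : ℕ → ℝ) (n : ℕ) :
    ((n : ℝ) + 1) * a x (n + 1) =
      ∑ i ∈ Finset.range (n + 1), x (i + 1) / (i.factorial : ℝ) * a x (n - i) := by
  have h1 : ∀ k, PowerSeries.coeff (n + 1) (F x ^ (k + 1)) * ((n : ℝ) + 1) / ((k + 1).factorial : ℝ)
      = ∑ i ∈ Finset.range (n + 1), x (i + 1) / (i.factorial : ℝ) *
        (PowerSeries.coeff (n - i) (F x ^ k) / (k.factorial : ℝ)) := by
    intro k
    rw [← PowerSeries.coeff_derivative, PowerSeries.derivative_pow]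
    have : (((k + 1 : ℕ) : PowerSeries ℝ) * F x ^ (k + 1 - 1) * PowerSeries.derivative ℝ (F x))
        = (k + 1) • (PowerSeries.derivative ℝ (F x) * F x ^ k) := by
      rw [nsmul_eq_mul, Nat.add_sub_cancel]; ring
    rw [this, map_nsmul, PowerSeries.coeff_mul,
      Finset.Nat.sum_antidiagonal_eq_sum_range_succ_mk, nsmul_eq_mul, Finset.mul_sum,
      Finset.sum_div]
    refine Finset.sum_congr rfl fun i _ => ?_
    rw [PowerSeries.coeff_derivative, F, PowerSeries.coeff_succ_X_mul, G, PowerSeries.coeff_mk,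
      Nat.factorial_succ, Nat.factorial_succ]
    push_cast
    field_simp
  rw [a, Finset.sum_range_succ', mul_add, Finset.mul_sum]
  have h0 : PowerSeries.coeff (n + 1) (F x ^ 0) = 0 := by simp [PowerSeries.coeff_one]
  rw [h0, zero_div, mul_zero, add_zero]
  have h2 : ∀ k ∈ Finset.range (n + 1), ((n : ℝ) + 1) *
      (PowerSeries.coeff (n + 1) (F x ^ (k + 1)) / ((k + 1).factorial : ℝ))
      = ∑ i ∈ Finset.range (n + 1), x (i + 1) / (i.factorial : ℝ) *
        (PowerSeries.coeff (n - i) (F x ^ k) / (k.factorial : ℝ)) := by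
    intro k _
    rw [← h1]; ring
  rw [Finset.sum_congr rfl h2, Finset.sum_comm]
  refine Finset.sum_congr rfl fun i _ => ?_
  rw [← Finset.mul_sum, ← a_eq x (n - i) (n + 1) (by omega)]

lemma F_smul (c : ℝ) (x : ℕ → ℝ) : F (fun i => c * x i) = c • F x := by
  rw [F, F, ← mul_smul_comm]
  congr 1
  ext i
  simp [G, mul_div_assoc]

lemma bell_total (c : ℝ) (x : ℕ → ℝ) (n : ℕ) (hn : 1 ≤ n) :
    ∑ k ∈ Finset.Icc 1 n, c ^ k * bellPoly n k x
      = (n.factorial : ℝ) * a (fun i => c * x i) n := by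
  rw [a, Finset.sum_range_succ']
  have h0 : PowerSeries.coeff n (F (fun i => c * x i) ^ 0) = 0 := by
    rw [pow_zero, PowerSeries.coeff_one, if_neg (by omega)]
  rw [h0, zero_div, add_zero, Finset.mul_sum, Finset.range_eq_Ico,
    Finset.sum_Ico_add' (fun k => (n.factorial : ℝ) *
      (PowerSeries.coeff n (F (fun i => c * x i) ^ k) / (k.factorial : ℝ))) 0 n 1]
  refine Finset.sum_congr (by ext; simp only [Finset.mem_Icc, Finset.mem_Ico]; omega) fun k hk => ?_
  simp only [Finset.mem_Ico] at hk
  rw [bell_eq n k (by omega), F_smul, smul_pow, PowerSeries.coeff_smul]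
  simp only [smul_eq_mul]; ring

/-- A sequence satisfying the moment recursion is given by Bell polynomials. -/
lemma moments_bell (c : ℝ) (x : ℕ → ℝ) (A : ℕ → ℝ) (n : ℕ) (hn : 1 ≤ n) (h0 : A 0 = 1)
    (hrec : ∀ m, m < n → A (m + 1) = ∑ i ∈ Finset.range (m + 1),
      (m.choose i : ℝ) * (c * x (i + 1)) * A (m - i)) :
    A n = ∑ k ∈ Finset.Icc 1 n, c ^ k * bellPoly n k x := by
  rw [bell_total c x n hn]
  have key : ∀ m, m ≤ n → A m = (m.factorial : ℝ) * a (fun i => c * x i) m := by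
    intro m
    induction m using Nat.strong_induction_on with
    | _ m ih =>
      intro hm
      cases m with
      | zero => simp [h0, a]
      | succ m =>
        rw [hrec m (by omega), Nat.factorial_succ]
        push_cast
        rw [show ((m : ℝ) + 1) * (m.factorial : ℝ) * a (fun i => c * x i) (m + 1)
          = (m.factorial : ℝ) * (((m : ℝ) + 1) * a (fun i => c * x i) (m + 1)) by ring,
          a_rec, Finset.mul_sum]
        refine Finset.sum_congr rfl fun i hi => ?_
        simp only [Finset.mem_range] at hi
        rw [ih (m - i) (by omega) (by omega)]
        have := Nat.choose_mul_factorial_mul_factorial (show i ≤ m by omega)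
        have h' : (m.factorial : ℝ) = m.choose i * i.factorial * (m - i).factorial := by
          exact_mod_cast this.symm
        rw [h']
        field_simp
  exact key n le_rfl

end OutletMoment

namespace OutletMoment

open ProbabilityTheory

section general
variable {Ω : Type*} [MeasurableSpace Ω]

lemma integrable_exp_neg {X : Ω → ℝ} {μ : Measure Ω} [IsFiniteMeasure μ] (hX : Measurable X)
    (h0 : ∀ᵐ ω ∂μ, 0 ≤ X ω) {t : ℝ} (ht : t ≤ 0) :
    Integrable (fun ω => Real.exp (t * X ω)) μ := by
  refine Integrable.of_bound (C := 1) (by fun_prop) ?_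
  filter_upwards [h0] with ω hω
  rw [Real.norm_eq_abs, abs_of_pos (Real.exp_pos _), Real.exp_le_one_iff]
  exact mul_nonpos_of_nonpos_of_nonneg ht hω

lemma mem_interior_neg {X : Ω → ℝ} {μ : Measure Ω} [IsFiniteMeasure μ] (hX : Measurable X)
    (h0 : ∀ᵐ ω ∂μ, 0 ≤ X ω) {t : ℝ} (ht : t < 0) :
    t ∈ interior (integrableExpSet X μ) := by
  rw [mem_interior]
  exact ⟨Set.Iio 0, fun s hs => integrable_exp_neg hX h0 (le_of_lt hs), isOpen_Iio, ht⟩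

/-- the sequence `-1/(q+1)` -/
def tq (q : ℕ) : ℝ := -(1 / ((q : ℝ) + 1))

lemma tq_neg (q : ℕ) : tq q < 0 := by
  unfold tq
  have : (0 : ℝ) < 1 / ((q : ℝ) + 1) := by positivity
  linarith

lemma tq_tendsto : Tendsto tq atTop (𝓝 0) := by
  have := (tendsto_one_div_add_atTop_nhds_zero_nat (𝕜 := ℝ)).neg
  rw [neg_zero] at this
  exact this

lemma tendsto_pt (x : ℝ) (i : ℕ) :
    Tendsto (fun q => x ^ i * Real.exp (tq q * x)) atTop (𝓝 (x ^ i)) := by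
  have h : Tendsto (fun q => x ^ i * Real.exp (tq q * x)) atTop (𝓝 (x ^ i * Real.exp (0 * x))) :=
    ((Real.continuous_exp.tendsto _).comp (tq_tendsto.mul_const x)).const_mul _
  simpa using h

lemma tendsto_int {X : Ω → ℝ} {μ : Measure Ω} (hX : Measurable X)
    (h0 : ∀ᵐ ω ∂μ, 0 ≤ X ω) (i : ℕ) (hi : Integrable (fun ω => X ω ^ i) μ) :
    Tendsto (fun q => ∫ ω, X ω ^ i * Real.exp (tq q * X ω) ∂μ) atTop (𝓝 (∫ ω, X ω ^ i ∂μ)) := by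
  refine tendsto_integral_of_dominated_convergence (fun ω => |X ω ^ i|) ?_ hi.abs ?_ ?_
  · intro q; fun_prop
  · intro q
    filter_upwards [h0] with ω hω
    rw [norm_mul, Real.norm_eq_abs, Real.norm_eq_abs, abs_of_pos (Real.exp_pos _)]
    refine mul_le_of_le_one_right (abs_nonneg _) ?_
    rw [Real.exp_le_one_iff]
    exact mul_nonpos_of_nonpos_of_nonneg (tq_neg q).le hω
  · filter_upwards with ω
    exact tendsto_pt (X ω) i

lemma moment_step {X : Ω → ℝ} {κ : Measure Ω} [IsFiniteMeasure κ] (hX : Measurable X)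
    (hX0 : ∀ᵐ ω ∂κ, 0 ≤ X ω) (g : Measure ℝ) [IsFiniteMeasure g]
    (hg0 : ∀ᵐ x ∂g, 0 ≤ x)
    (hd : ∀ t < 0, HasDerivAt (mgf id g) (mgf X κ t * mgf id g t) t) (m : ℕ)
    (hκ : ∀ i ≤ m, Integrable (fun ω => X ω ^ i) κ)
    (hg : ∀ i ≤ m, Integrable (fun x => x ^ i) g) :
    Integrable (fun x => x ^ (m + 1)) g ∧
    ∫ x, x ^ (m + 1) ∂g = ∑ i ∈ Finset.range (m + 1),
      (m.choose i : ℝ) * (∫ ω, X ω ^ i ∂κ) * ∫ x, x ^ (m - i) ∂g := by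
  have hgI : ∀ t < 0, t ∈ interior (integrableExpSet id g) :=
    fun t ht => mem_interior_neg measurable_id hg0 ht
  have hκI : ∀ t < 0, t ∈ interior (integrableExpSet X κ) :=
    fun t ht => mem_interior_neg hX hX0 ht
  have hid : ∀ t < 0, ∫ x, x ^ (m + 1) * Real.exp (t * x) ∂g = ∑ i ∈ Finset.range (m + 1),
      (m.choose i : ℝ) * (∫ ω, X ω ^ i * Real.exp (t * X ω) ∂κ) *
        ∫ x, x ^ (m - i) * Real.exp (t * x) ∂g := by
    intro t ht
    have h1 := iteratedDeriv_mgf (hgI t ht) (m + 1)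
    simp only [id] at h1
    rw [← h1, iteratedDeriv_succ']
    have h2 : deriv (mgf id g) =ᶠ[𝓝 t] mgf X κ * mgf id g := by
      filter_upwards [isOpen_Iio.mem_nhds ht] with s hs
      exact (hd s hs).deriv
    rw [h2.iteratedDeriv_eq, iteratedDeriv_mul (analyticAt_mgf (hκI t ht)).contDiffAt
      (analyticAt_mgf (hgI t ht)).contDiffAt]
    refine Finset.sum_congr rfl fun i _ => ?_
    rw [iteratedDeriv_mgf (hκI t ht), iteratedDeriv_mgf (hgI t ht)]
    rfl
  have hlim : Tendsto (fun q => ∫ x, x ^ (m + 1) * Real.exp (tq q * x) ∂g) atTop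
      (𝓝 (∑ i ∈ Finset.range (m + 1),
        (m.choose i : ℝ) * (∫ ω, X ω ^ i ∂κ) * ∫ x, x ^ (m - i) ∂g)) := by
    simp_rw [fun q => hid (tq q) (tq_neg q)]
    refine tendsto_finsetSum _ fun i hi => ?_
    simp only [Finset.mem_range] at hi
    exact ((tendsto_int hX hX0 i (hκ i (by omega))).const_mul _).mul
      (tendsto_int measurable_id hg0 (m - i) (hg _ (by omega)))
  have hint : Integrable (fun x => x ^ (m + 1)) g := by
    refine integrable_of_tendsto (G := fun q x => x ^ (m + 1) * Real.exp (tq q * x)) ?_ ?_ ?_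
    · filter_upwards with x
      exact tendsto_pt x (m + 1)
    · intro q; fun_prop
    · have he : ∀ q, ∫⁻ x, ‖x ^ (m + 1) * Real.exp (tq q * x)‖ₑ ∂g
          = ENNReal.ofReal (∫ x, x ^ (m + 1) * Real.exp (tq q * x) ∂g) := by
        intro q
        have hi : Integrable (fun x => x ^ (m + 1) * Real.exp (tq q * x)) g :=
          integrable_pow_mul_exp_of_mem_interior_integrableExpSet (hgI _ (tq_neg q)) (m + 1)
        rw [ofReal_integral_eq_lintegral_ofReal hi]
        · refine lintegral_congr_ae ?_
          filter_upwards [hg0] with x hx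
          rw [Real.enorm_eq_ofReal (by positivity)]
        · filter_upwards [hg0] with x hx
          simp only [Pi.zero_apply]
          positivity
      simp_rw [he]
      have hl := ((ENNReal.continuous_ofReal.tendsto _).comp hlim).liminf_eq
      exact fun h => ENNReal.ofReal_ne_top (hl.symm.trans h)
  exact ⟨hint, tendsto_nhds_unique (tendsto_int measurable_id hg0 (m + 1) hint) hlim⟩

end general

lemma ae_nonneg_of_Ici (μ : Measure ℝ) [IsProbabilityMeasure μ] (h : μ (Set.Ici (0:ℝ)) = 1) :
    ∀ᵐ x ∂μ, 0 ≤ x := by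
  have := (prob_compl_eq_zero_iff (μ := μ) measurableSet_Ici).2 h
  rw [ae_iff]
  simpa [Set.compl_def] using this

end OutletMoment

open OutletMoment ProbabilityTheory

/-- **Invariant moments of the outlet discharge.** If the rainfall distribution `μ_P`
has finite moments `μ⁽ⁱ⁾` for `i = 1,…,n`, then the `n`-th moment of the invariant
outlet-discharge distribution `g_r` is finite and equals
`Σ_{k=1}^n (λ/H_r)^k · B_{n,k}(μ⁽¹⁾d_1, …, μ⁽ⁿ⁻ᵏ⁺¹⁾d_{n−k+1})`,
where `d_i = ∫_0^1 M_r(u)^i/u du`. -/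
theorem invariant_moment_outlet
    (lam Hr : ℝ) (hlam : 0 < lam) (hHr : 0 < Hr)
    (Mr : ℝ → ℝ) (hMr_meas : Measurable Mr)
    (hMr_nonneg : ∀ u ∈ Set.Icc (0:ℝ) 1, 0 ≤ Mr u)
    (hMr_bdd : ∃ C : ℝ, ∀ u ∈ Set.Icc (0:ℝ) 1, Mr u ≤ C)
    (hMr_int : IntegrableOn (fun u => Mr u / u) (Set.Ioc (0:ℝ) 1))
    (μP : Measure ℝ) [IsProbabilityMeasure μP] (hμP : μP (Set.Ici (0:ℝ)) = 1)
    (gr : Measure ℝ) [IsProbabilityMeasure gr] (hgr : gr (Set.Ici (0:ℝ)) = 1)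
    (hgrLaplace : ∀ s : ℝ, 0 ≤ s →
      ∫ x, Real.exp (-(s * x)) ∂gr
        = Real.exp (-(lam / Hr * ∫ u in Set.Ioc (0:ℝ) 1,
            (1 - ∫ y, Real.exp (-(Mr u * s * y)) ∂μP) / u)))
    (n : ℕ) (hn : 1 ≤ n)
    (hmom : ∀ i ∈ Finset.Icc 1 n, Integrable (fun y => y ^ i) μP) :
    Integrable (fun x => x ^ n) gr ∧
    ∫ x, x ^ n ∂gr
      = ∑ k ∈ Finset.Icc 1 n, (lam / Hr) ^ k *
          bellPoly n k (fun i =>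
            (∫ y, y ^ i ∂μP) * ∫ u in Set.Ioc (0:ℝ) 1, (Mr u) ^ i / u) := by
  obtain ⟨C, hC⟩ := hMr_bdd
  have hc : 0 < lam / Hr := div_pos hlam hHr
  set c := lam / Hr with hcdef
  have hP0 := ae_nonneg_of_Ici μP hμP
  have hg0 := ae_nonneg_of_Ici gr hgr
  set ν : Measure ℝ := volume.restrict (Set.Ioc (0:ℝ) 1) with hν
  set π : Measure (ℝ × ℝ) := ν.prod μP with hπ
  have hν0 : ∀ᵐ u ∂ν, u ∈ Set.Ioc (0:ℝ) 1 := ae_restrict_mem measurableSet_Ioc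
  have hπ1 : ∀ᵐ p ∂π, p.1 ∈ Set.Ioc (0:ℝ) 1 := Measure.quasiMeasurePreserving_fst.ae hν0
  have hπ2 : ∀ᵐ p ∂π, 0 ≤ p.2 := Measure.quasiMeasurePreserving_snd.ae hP0
  set X : ℝ × ℝ → ℝ := fun p => Mr p.1 * p.2 with hXdef
  have hX : Measurable X := by fun_prop
  set w : ℝ × ℝ → ℝ := fun p => c * (Mr p.1 / p.1 * p.2) with hwdef
  have hwm : Measurable w := by fun_prop
  have hπX : ∀ᵐ p ∂π, 0 ≤ X p := by
    filter_upwards [hπ1, hπ2] with p h1 h2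
    exact mul_nonneg (hMr_nonneg _ ⟨h1.1.le, h1.2⟩) h2
  have hπw : ∀ᵐ p ∂π, 0 ≤ w p := by
    filter_upwards [hπ1, hπ2] with p h1 h2
    exact mul_nonneg hc.le (mul_nonneg (div_nonneg (hMr_nonneg _ ⟨h1.1.le, h1.2⟩) h1.1.le) h2)
  have hP1 : Integrable (fun y : ℝ => y) μP := by
    simpa using hmom 1 (by simp [hn])
  have hwi : Integrable w π := (Integrable.mul_prod hMr_int hP1).const_mul c
  set κ : Measure (ℝ × ℝ) := π.withDensity (fun p => ENNReal.ofReal (w p)) with hκ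
  have : IsFiniteMeasure κ := isFiniteMeasure_withDensity_ofReal hwi.2
  have hκX : ∀ᵐ p ∂κ, 0 ≤ X p := (withDensity_absolutelyContinuous π _).ae_le hπX
  have hκint : ∀ f : ℝ × ℝ → ℝ, ∫ p, f p ∂κ = ∫ p, w p * f p ∂π := by
    intro f
    rw [hκ, integral_withDensity_eq_integral_toReal_smul (by fun_prop) (by simp)]
    refine integral_congr_ae ?_
    filter_upwards [hπw] with p hp
    simp [ENNReal.toReal_ofReal hp]
  have hκI : ∀ f : ℝ × ℝ → ℝ, Integrable (fun p => w p * f p) π → Integrable f κ := by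
    intro f hf
    rw [hκ, integrable_withDensity_iff_integrable_smul₀' (by fun_prop) (by simp)]
    refine hf.congr ?_
    filter_upwards [hπw] with p hp
    simp [ENNReal.toReal_ofReal hp]
  have hwX : ∀ i : ℕ, (fun p => w p * X p ^ i)
      = fun p : ℝ × ℝ => c * ((Mr p.1 ^ (i + 1) / p.1) * p.2 ^ (i + 1)) := by
    intro i
    funext p
    simp only [hwdef, hXdef]
    ring
  have hMi : ∀ i : ℕ, Integrable (fun u => Mr u ^ (i + 1) / u) ν := by
    intro i
    have h := Integrable.bdd_mul (c := C ^ i) (f := fun u => Mr u ^ i) hMr_int (by fun_prop) (by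
      filter_upwards [hν0] with u hu
      have hu' : u ∈ Set.Icc (0:ℝ) 1 := ⟨hu.1.le, hu.2⟩
      rw [norm_pow, Real.norm_eq_abs, abs_of_nonneg (hMr_nonneg u hu')]
      exact pow_le_pow_left₀ (hMr_nonneg u hu') (hC u hu') i)
    refine h.congr (Eventually.of_forall fun u => ?_)
    simp only
    ring
  have hκm : ∀ i < n, Integrable (fun p => X p ^ i) κ := by
    intro i hi
    refine hκI _ ?_
    rw [hwX]
    exact (Integrable.mul_prod (hMi i)
      (hmom (i + 1) (by simp only [Finset.mem_Icc]; omega))).const_mul c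
  have hκv : ∀ i : ℕ, ∫ p, X p ^ i ∂κ
      = c * ((∫ y, y ^ (i + 1) ∂μP) * ∫ u in Set.Ioc (0:ℝ) 1, (Mr u) ^ (i + 1) / u) := by
    intro i
    rw [hκint, hwX, integral_const_mul,
      integral_prod_mul (fun u => Mr u ^ (i + 1) / u) (fun y => y ^ (i + 1)), mul_comm (∫ y, y ^ (i + 1) ∂μP)]
  -- the exponent
  set Fn : ℝ → ℝ × ℝ → ℝ := fun t p => c * ((Real.exp (t * X p) - 1) / p.1) with hFn
  have hFi : ∀ t ≤ 0, Integrable (Fn t) π := by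
    intro t ht
    refine Integrable.mono' (hwi.const_mul |t|) (by fun_prop) ?_
    filter_upwards [hπ1, hπX] with p h1 h2
    have h3 : Real.exp (t * X p) ≤ 1 :=
      Real.exp_le_one_iff.2 (mul_nonpos_of_nonpos_of_nonneg ht h2)
    have h4 := Real.add_one_le_exp (t * X p)
    have h5 : |Real.exp (t * X p) - 1| ≤ |t| * X p := by
      rw [abs_of_nonpos (by linarith), abs_of_nonpos ht]; linarith
    have hp : 0 < p.1 := h1.1
    simp only [hFn, hwdef]
    rw [Real.norm_eq_abs, abs_mul, abs_of_pos hc, abs_div, abs_of_pos hp]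
    calc c * (|Real.exp (t * X p) - 1| / p.1) ≤ c * (|t| * X p / p.1) := by gcongr
      _ = |t| * (c * (Mr p.1 / p.1 * p.2)) := by simp only [hXdef]; ring
  have hmgf : ∀ t ≤ 0, mgf id gr t = Real.exp (∫ p, Fn t p ∂π) := by
    intro t ht
    have h := hgrLaplace (-t) (by linarith)
    have e1 : mgf id gr t = ∫ x, Real.exp (-(-t * x)) ∂gr := by
      simp [mgf]
    rw [e1, h, integral_prod _ (hFi t ht)]
    congr 1
    rw [← mul_neg, ← integral_neg, ← integral_const_mul]
    refine integral_congr_ae ?_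
    filter_upwards [hν0] with u hu
    have hi : Integrable (fun y => Real.exp (t * (Mr u * y))) μP := by
      refine integrable_exp_neg (X := fun y => Mr u * y) (by fun_prop) ?_ ht
      filter_upwards [hP0] with y hy
      exact mul_nonneg (hMr_nonneg u ⟨hu.1.le, hu.2⟩) hy
    simp only [hFn, hXdef]
    rw [integral_const_mul, integral_div, integral_sub hi (integrable_const _)]
    have e2 : ∀ y, -(Mr u * -t * y) = t * (Mr u * y) := fun y => by ring
    simp only [e2, integral_const, probReal_univ, smul_eq_mul, mul_one]
    ring
  have hd : ∀ t < 0, HasDerivAt (mgf id gr) (mgf X κ t * mgf id gr t) t := by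
    intro t ht
    have h1 := (hasDerivAt_integral_of_dominated_loc_of_deriv_le (μ := π) (F := Fn)
      (F' := fun s p => w p * Real.exp (s * X p)) (bound := w) (x₀ := t)
      (isOpen_Iio.mem_nhds ht) (Eventually.of_forall fun s => by fun_prop) (hFi t ht.le)
      (by fun_prop) (by
        filter_upwards [hπw, hπX] with p hp hx s hs
        rw [norm_mul, Real.norm_eq_abs, Real.norm_eq_abs, abs_of_nonneg hp,
          abs_of_pos (Real.exp_pos _)]
        refine mul_le_of_le_one_right hp ?_
        exact Real.exp_le_one_iff.2 (mul_nonpos_of_nonpos_of_nonneg (le_of_lt hs) hx)) hwi (by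
        filter_upwards with p s hs
        have := ((((hasDerivAt_id s).mul_const (X p)).exp.sub_const 1).div_const p.1).const_mul c
        refine this.congr_deriv ?_
        simp only [hwdef, hXdef, id]
        ring)).2
    have h2 := h1.exp
    have h3 : mgf id gr =ᶠ[𝓝 t] fun s => Real.exp (∫ p, Fn s p ∂π) := by
      filter_upwards [isOpen_Iio.mem_nhds ht] with s hs
      exact hmgf s (le_of_lt hs)
    refine (h2.congr_of_eventuallyEq h3).congr_deriv ?_
    rw [hmgf t ht.le, mgf, hκint, mul_comm]
  have hgm : ∀ m ≤ n, ∀ i ≤ m, Integrable (fun x => x ^ i) gr := by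
    intro m
    induction m with
    | zero =>
      intro _ i hi
      obtain rfl : i = 0 := by omega
      simp
    | succ m ih =>
      intro hm i hi
      rcases Nat.lt_or_ge i (m + 1) with h | h
      · exact ih (by omega) i (by omega)
      · obtain rfl : i = m + 1 := by omega
        exact (moment_step hX hκX gr hg0 hd m (fun j hj => hκm j (by omega)) (ih (by omega))).1
  refine ⟨hgm n le_rfl n le_rfl, ?_⟩
  refine moments_bell c _ (fun m => ∫ x, x ^ m ∂gr) n hn (by simp) ?_
  intro m hm
  have h := (moment_step hX hκX gr hg0 hd m (fun j hj => hκm j (by omega)) (hgm m hm.le)).2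
  simp only [hκv] at h
  exact h


end
end

section
/- Let 0 < α < 1 and k > 0, and suppose μ_P is the Pareto(α,k) distribution, with density f_P(y) = α·k^α·y^{−α−1} for y > k and 0 otherwise. Suppose moreover that d_α := ∫_0^1 M_r(u)^α/u du < ∞. Then the tail of the invariant outlet-discharge distribution satisfies lim_{x→∞} x^α · g_r((x,∞)) = (λ·k^α/H_r)·d_α. -/
open MeasureTheory Filter Topology

noncomputable section


def ww (α y : ℝ) : ℝ := α * y ^ (-α - 1)
def wJ (α : ℝ) : ℝ := ∫ z in Set.Ioi (0:ℝ), (1 - Real.exp (-z)) * ww α z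

lemma ww_nonneg {α y : ℝ} (hα : 0 < α) (hy : 0 ≤ y) : 0 ≤ ww α y := by
  unfold ww; positivity

lemma ww_meas (α : ℝ) : Measurable (ww α) := by
  unfold ww; fun_prop

lemma ww_int_tail {α A : ℝ} (hα : 0 < α) (hA : 0 < A) : IntegrableOn (ww α) (Set.Ioi A) := by
  unfold ww
  exact (integrableOn_Ioi_rpow_of_lt (by linarith) hA).const_mul α

lemma ww_tail {α A : ℝ} (hα : 0 < α) (hA : 0 < A) : ∫ y in Set.Ioi A, ww α y = A ^ (-α) := by
  unfold ww
  rw [integral_const_mul, integral_Ioi_rpow_of_lt (by linarith) hA]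
  have : -α - 1 + 1 = -α := by ring
  rw [this]; field_simp

lemma wJ_int {α : ℝ} (hα : 0 < α) (hα1 : α < 1) :
    IntegrableOn (fun z => (1 - Real.exp (-z)) * ww α z) (Set.Ioi (0:ℝ)) := by
  have hm : Measurable (fun z => (1 - Real.exp (-z)) * ww α z) := by
    have := ww_meas α
    fun_prop
  rw [← Set.Ioc_union_Ioi_eq_Ioi (zero_le_one : (0:ℝ) ≤ 1)]
  refine IntegrableOn.union ?_ ?_
  · have h1 : IntegrableOn (fun z : ℝ => α * z ^ (-α)) (Set.Ioc 0 1) := by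
      have := (intervalIntegral.intervalIntegrable_rpow' (a := 0) (b := 1) (r := -α) (by linarith))
      rw [intervalIntegrable_iff_integrableOn_Ioc_of_le zero_le_one] at this
      exact this.const_mul α
    refine Integrable.mono' h1 hm.aestronglyMeasurable ?_
    filter_upwards [ae_restrict_mem measurableSet_Ioc] with z hz
    have hz0 := hz.1
    have e1 : 0 ≤ 1 - Real.exp (-z) := by
      have := Real.exp_le_one_iff.2 (by linarith : -z ≤ 0); linarith
    have e2 : 1 - Real.exp (-z) ≤ z := by
      have := Real.add_one_le_exp (-z); linarith
    rw [Real.norm_of_nonneg (mul_nonneg e1 (ww_nonneg hα hz0.le))]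
    calc _ ≤ z * ww α z := mul_le_mul_of_nonneg_right e2 (ww_nonneg hα hz0.le)
      _ = α * z ^ (-α) := by
        unfold ww
        have : z ^ (-α) = z ^ (-α - 1) * z := by
          rw [← Real.rpow_add_one hz0.ne']; congr 1; ring
        rw [this]; ring
  · refine Integrable.mono' (ww_int_tail hα one_pos) hm.aestronglyMeasurable ?_
    filter_upwards [ae_restrict_mem measurableSet_Ioi] with z hz
    have hz0 : 0 < z := lt_trans one_pos hz
    have e1 : 0 ≤ 1 - Real.exp (-z) := by
      have := Real.exp_le_one_iff.2 (by linarith : -z ≤ 0); linarith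
    have e2 : 1 - Real.exp (-z) ≤ 1 := by
      have := Real.exp_pos (-z); linarith
    rw [Real.norm_of_nonneg (mul_nonneg e1 (ww_nonneg hα hz0.le))]
    nlinarith [ww_nonneg hα hz0.le]

/-- scaling -/
lemma ww_scale {α t a : ℝ} (ht : 0 < t) (ha : 0 ≤ a) :
    ∫ y in Set.Ioi a, (1 - Real.exp (-(t * y))) * ww α y
      = t ^ α * ∫ z in Set.Ioi (t * a), (1 - Real.exp (-z)) * ww α z := by
  have h := integral_comp_mul_left_Ioi (fun z => (1 - Real.exp (-z)) * ww α z) a ht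
  have h2 : ∫ z in Set.Ioi (t * a), (1 - Real.exp (-z)) * ww α z
      = t * ∫ y in Set.Ioi a, (1 - Real.exp (-(t * y))) * ww α (t * y) := by
    rw [h, smul_eq_mul]; field_simp
  rw [h2, ← integral_const_mul, ← integral_const_mul]
  refine setIntegral_congr_fun measurableSet_Ioi fun y hy => ?_
  have hy0 : 0 < y := lt_of_le_of_lt ha hy
  have : t ^ α * (t * t ^ (-α - 1)) = 1 := by
    rw [mul_comm t, ← Real.rpow_add_one ht.ne', ← Real.rpow_add ht]; ring_nf; simp
  simp only [ww]
  rw [Real.mul_rpow ht.le hy0.le]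
  linear_combination (-(1 - Real.exp (-(t * y))) * α * y ^ (-α - 1)) * this

/-- integrability of scaled -/
lemma ww_scale_int {α t : ℝ} (hα : 0 < α) (hα1 : α < 1) (ht : 0 < t) :
    IntegrableOn (fun y => (1 - Real.exp (-(t * y))) * ww α y) (Set.Ioi (0:ℝ)) := by
  have h := (integrableOn_Ioi_comp_mul_left_iff (fun z => (1 - Real.exp (-z)) * ww α z) 0 ht).2
    (by simpa using wJ_int hα hα1)
  refine (h.const_mul (t ^ (α + 1))).congr ?_
  filter_upwards [ae_restrict_mem measurableSet_Ioi] with y hy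
  have hy0 : 0 < y := hy
  have : t ^ (α+1) * t ^ (-α - 1) = 1 := by
    rw [← Real.rpow_add ht]; ring_nf; simp
  simp only [ww]
  rw [Real.mul_rpow ht.le hy0.le]
  linear_combination ((1 - Real.exp (-(t * y))) * α * y ^ (-α - 1)) * this

lemma pareto_psi {α k t : ℝ} (hα : 0 < α) (hk : 0 < k) (ht : 0 < t) :
    1 - ∫ y, Real.exp (-(t * y)) ∂(ProbabilityTheory.paretoMeasure k α)
      = k ^ α * (t ^ α * ∫ z in Set.Ioi (t * k), (1 - Real.exp (-z)) * ww α z) := by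
  have hpm : Measurable (ProbabilityTheory.paretoPDF k α) := by
    unfold ProbabilityTheory.paretoPDF; fun_prop
  have h1 : ∫ y, Real.exp (-(t * y)) ∂(ProbabilityTheory.paretoMeasure k α)
      = k ^ α * ∫ y in Set.Ioi k, Real.exp (-(t * y)) * ww α y := by
    unfold ProbabilityTheory.paretoMeasure
    rw [integral_withDensity_eq_integral_toReal_smul hpm
      (ae_of_all _ fun _ => ENNReal.ofReal_lt_top)]
    rw [← integral_Ici_eq_integral_Ioi, ← integral_const_mul,
      ← integral_indicator measurableSet_Ici]
    congr 1
    ext y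
    simp only [ProbabilityTheory.paretoPDF]
    rw [ENNReal.toReal_ofReal (ProbabilityTheory.paretoPDFReal_nonneg hk.le hα.le y)]
    simp only [ProbabilityTheory.paretoPDFReal, Set.indicator, Set.mem_Ici, ww, smul_eq_mul]
    split_ifs
    · rw [show -(α + 1) = -α - 1 by ring]; ring
    · simp
  have h2 : IntegrableOn (fun y => Real.exp (-(t * y)) * ww α y) (Set.Ioi k) := by
    have hm : Measurable (fun y => Real.exp (-(t * y)) * ww α y) := by
      have := ww_meas α
      fun_prop
    refine Integrable.mono' (ww_int_tail hα hk) hm.aestronglyMeasurable ?_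
    filter_upwards [ae_restrict_mem measurableSet_Ioi] with z hz
    have hz0 : 0 < z := lt_trans hk hz
    have e1 : Real.exp (-(t * z)) ≤ 1 := by
      rw [Real.exp_le_one_iff]; nlinarith
    rw [Real.norm_of_nonneg (mul_nonneg (Real.exp_pos _).le (ww_nonneg hα hz0.le))]
    nlinarith [ww_nonneg hα hz0.le]
  rw [← ww_scale ht hk.le, h1]
  simp only [sub_mul, one_mul]
  rw [integral_sub (ww_int_tail hα hk) h2, ww_tail hα hk, mul_sub, ← Real.rpow_add hk]
  simp

lemma J_nonneg_on {α z : ℝ} (hα : 0 < α) (hz : 0 < z) : 0 ≤ (1 - Real.exp (-z)) * ww α z := by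
  have := Real.exp_le_one_iff.2 (by linarith : -z ≤ 0)
  exact mul_nonneg (by linarith) (ww_nonneg hα hz.le)

lemma abel {lam Hr : ℝ} {Mr : ℝ → ℝ} (hMr_meas : Measurable Mr)
    (hMr_nonneg : ∀ u ∈ Set.Icc (0:ℝ) 1, 0 ≤ Mr u)
    {α k : ℝ} (hα : 0 < α) (hα1 : α < 1) (hk : 0 < k)
    (hdα : IntegrableOn (fun u => (Mr u) ^ α / u) (Set.Ioc (0:ℝ) 1)) :
    Tendsto (fun s : ℝ => s ^ (-α) * (lam / Hr * ∫ u in Set.Ioc (0:ℝ) 1,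
      (1 - ∫ y, Real.exp (-(Mr u * s * y)) ∂(ProbabilityTheory.paretoMeasure k α)) / u))
      (𝓝[>] 0) (𝓝 (lam * k ^ α / Hr * (∫ u in Set.Ioc (0:ℝ) 1, (Mr u) ^ α / u) * wJ α)) := by
  have := ProbabilityTheory.isProbabilityMeasure_paretoMeasure hk hα
  set K : ℝ → ℝ := fun a => ∫ z in Set.Ioi a, (1 - Real.exp (-z)) * ww α z with hK
  have hKle : ∀ a, 0 < a → K a ≤ wJ α := fun a ha => by
    refine setIntegral_mono_set (wJ_int hα hα1) ?_ (Set.Ioi_subset_Ioi ha.le).eventuallyLE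
    filter_upwards [ae_restrict_mem measurableSet_Ioi] with z hz using J_nonneg_on hα hz
  have hK0 : ∀ a, 0 < a → 0 ≤ K a := fun a ha =>
    setIntegral_nonneg measurableSet_Ioi fun z hz => J_nonneg_on hα (ha.trans hz)
  have hKlim : ∀ m, 0 < m → Tendsto (fun s : ℝ => K (m * s * k)) (𝓝[>] 0) (𝓝 (wJ α)) := by
    intro m hm
    have h0 : Tendsto (fun s : ℝ => m * s * k) (𝓝[>] 0) (𝓝 0) := by
      have : Tendsto (fun s : ℝ => m * s * k) (𝓝 0) (𝓝 (m * 0 * k)) := by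
        apply Continuous.tendsto; fun_prop
      simp only [mul_zero, zero_mul] at this
      exact this.mono_left nhdsWithin_le_nhds
    have := (aecover_Ioi_of_Ioi (μ := volume) h0).integral_tendsto_of_countably_generated
      (wJ_int hα hα1)
    refine this.congr' ?_
    filter_upwards [self_mem_nhdsWithin] with s hs
    have hs0 : (0:ℝ) < s := hs
    rw [Measure.restrict_restrict measurableSet_Ioi, Set.inter_eq_left.2]
    exact Set.Ioi_subset_Ioi (by positivity)
  have key : ∀ s u, 0 < s → 0 < Mr u →
      s ^ (-α) * ((1 - ∫ y, Real.exp (-(Mr u * s * y)) ∂(ProbabilityTheory.paretoMeasure k α)) / u)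
      = k ^ α * (Mr u ^ α / u) * K (Mr u * s * k) := by
    intro s u hs hm
    rw [pareto_psi hα hk (mul_pos hm hs), Real.mul_rpow hm.le hs.le]
    have : s ^ (-α) * s ^ α = 1 := by rw [← Real.rpow_add hs]; simp
    simp only [hK]
    linear_combination (k ^ α * (Mr u ^ α / u) * K (Mr u * s * k)) * this
  have main : Tendsto (fun s : ℝ => ∫ u in Set.Ioc (0:ℝ) 1,
      s ^ (-α) * ((1 - ∫ y, Real.exp (-(Mr u * s * y)) ∂(ProbabilityTheory.paretoMeasure k α)) / u))
      (𝓝[>] 0) (𝓝 (∫ u in Set.Ioc (0:ℝ) 1, k ^ α * (Mr u ^ α / u) * wJ α)) := by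
    refine tendsto_integral_filter_of_dominated_convergence
      (fun u => k ^ α * (Mr u ^ α / u) * wJ α) ?_ ?_ ((hdα.const_mul _).mul_const _) ?_
    · refine Eventually.of_forall fun s => ?_
      have hm : StronglyMeasurable (fun u => ∫ y, Real.exp (-(Mr u * s * y))
          ∂(ProbabilityTheory.paretoMeasure k α)) := by
        refine StronglyMeasurable.integral_prod_right (f := fun u y => Real.exp (-(Mr u * s * y))) ?_
        apply Measurable.stronglyMeasurable
        have : Measurable (fun p : ℝ × ℝ => Mr p.1) := hMr_meas.comp measurable_fst
        simp only [Function.uncurry_def]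
        fun_prop
      have hm' := hm.measurable
      apply Measurable.aestronglyMeasurable
      fun_prop
    · filter_upwards [self_mem_nhdsWithin] with s hs
      filter_upwards [ae_restrict_mem measurableSet_Ioc] with u hu
      have hs0 : (0:ℝ) < s := hs
      rcases (hMr_nonneg u ⟨hu.1.le, hu.2⟩).eq_or_lt with h | h
      · simp [← h, Real.zero_rpow hα.ne']
      · rw [key s u hs0 h]
        have hu0 := hu.1
        have hp : 0 < Mr u * s * k := by positivity
        have hc : 0 ≤ k ^ α * (Mr u ^ α / u) := by positivity
        rw [Real.norm_of_nonneg (mul_nonneg hc (hK0 _ hp))]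
        exact mul_le_mul_of_nonneg_left (hKle _ hp) hc
    · filter_upwards [ae_restrict_mem measurableSet_Ioc] with u hu
      rcases (hMr_nonneg u ⟨hu.1.le, hu.2⟩).eq_or_lt with h | h
      · simp [← h, Real.zero_rpow hα.ne']
      · refine ((hKlim _ h).const_mul (k ^ α * (Mr u ^ α / u))).congr' ?_
        filter_upwards [self_mem_nhdsWithin] with s hs
        exact (key s u hs h).symm
  have m2 := main.const_mul (lam / Hr)
  rw [integral_mul_const, integral_const_mul] at m2
  convert m2 using 2
  · rw [integral_const_mul]; ring
  · ring

lemma one_sub_exp_lim {α c : ℝ} (hα : 0 < α) {Ψ : ℝ → ℝ}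
    (h : Tendsto (fun s : ℝ => s ^ (-α) * Ψ s) (𝓝[>] 0) (𝓝 c)) :
    Tendsto (fun s : ℝ => s ^ (-α) * (1 - Real.exp (-Ψ s))) (𝓝[>] 0) (𝓝 c) := by
  have hs : Tendsto (fun s : ℝ => s ^ α) (𝓝[>] 0) (𝓝 0) := by
    have : Tendsto (fun s : ℝ => s ^ α) (𝓝 0) (𝓝 (0 ^ α)) :=
      (Real.continuousAt_rpow_const 0 α (Or.inr hα.le))
    rw [Real.zero_rpow hα.ne'] at this
    exact this.mono_left nhdsWithin_le_nhds
  have hΨ : Tendsto Ψ (𝓝[>] 0) (𝓝 0) := by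
    have := hs.mul h
    rw [zero_mul] at this
    refine this.congr' ?_
    filter_upwards [self_mem_nhdsWithin] with s hs
    have hs0 : (0:ℝ) < s := hs
    have : s ^ α * s ^ (-α) = 1 := by rw [← Real.rpow_add hs0]; simp
    rw [← mul_assoc, this, one_mul]
  -- exp(-x) = 1 - x * D x with D continuous at zero
  have hD : HasDerivAt (fun x : ℝ => 1 - Real.exp (-x)) 1 0 := by
    have := ((hasDerivAt_neg (0:ℝ)).exp).const_sub 1
    simpa using this
  have hc := (continuousAt_dslope_same (𝕜 := ℝ)).2 hD.differentiableAt
  have hc2 : Tendsto (fun s => dslope (fun x : ℝ => 1 - Real.exp (-x)) 0 (Ψ s)) (𝓝[>] 0) (𝓝 1) := by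
    have := hc.tendsto.comp hΨ
    rwa [dslope_same, hD.deriv] at this
  have h3 := h.mul hc2
  rw [mul_one] at h3
  refine h3.congr fun s => ?_
  have := sub_smul_dslope (fun x : ℝ => 1 - Real.exp (-x)) 0 (Ψ s)
  simp only [smul_eq_mul, neg_zero, Real.exp_zero, sub_self, sub_zero] at this
  rw [mul_assoc, this]

lemma poly_bdd (q : ℝ → ℝ) (hq : Continuous q) : ∃ C, ∀ t ∈ Set.Icc (0:ℝ) 1, ‖q t‖ ≤ C :=
  isCompact_Icc.exists_bound_of_continuousOn hq.continuousOn

lemma W_int {μ : Measure ℝ} {W T q : ℝ → ℝ} (hW : Integrable W μ) (hTm : Measurable T)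
    (hT : ∀ᵐ x ∂μ, T x ∈ Set.Icc (0:ℝ) 1) (hq : Continuous q) :
    Integrable (fun x => W x * q (T x)) μ := by
  obtain ⟨C, hC⟩ := poly_bdd q hq
  refine hW.mul_bdd (c := C) (hq.measurable.comp hTm).aestronglyMeasurable ?_
  filter_upwards [hT] with x hx using hC _ hx

lemma W_close {μ : Measure ℝ} {W T q p : ℝ → ℝ} {ε : ℝ} (hW : Integrable W μ)
    (hW0 : ∀ᵐ x ∂μ, 0 ≤ W x) (hTm : Measurable T)
    (hT : ∀ᵐ x ∂μ, T x ∈ Set.Icc (0:ℝ) 1) (hq : Continuous q) (hp : Continuous p)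
    (hqp : ∀ t ∈ Set.Icc (0:ℝ) 1, |p t - q t| < ε) :
    |∫ x, W x * p (T x) ∂μ - ∫ x, W x * q (T x) ∂μ| ≤ ε * ∫ x, W x ∂μ := by
  rw [← integral_sub (W_int hW hTm hT hp) (W_int hW hTm hT hq), ← integral_const_mul]
  rw [← Real.norm_eq_abs]
  refine norm_integral_le_of_norm_le (hW.const_mul ε) ?_
  filter_upwards [hT, hW0] with x hx hx0
  rw [← mul_sub, Real.norm_eq_abs, abs_mul, abs_of_nonneg hx0, mul_comm]
  exact mul_le_mul_of_nonneg_right (hqp _ hx).le hx0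

section Tauber
variable {α c : ℝ} {gr : Measure ℝ}

lemma T_gr (hpos : ∀ᵐ x ∂gr, 0 ≤ x) {s : ℝ} (hs : 0 ≤ s) :
    ∀ᵐ x ∂gr, Real.exp (-(s * x)) ∈ Set.Icc (0:ℝ) 1 := by
  filter_upwards [hpos] with x hx
  exact ⟨(Real.exp_pos _).le, Real.exp_le_one_iff.2 (by nlinarith [mul_nonneg hs hx])⟩

lemma T_vol : ∀ᵐ y ∂(volume.restrict (Set.Ioi (0:ℝ))), Real.exp (-y) ∈ Set.Icc (0:ℝ) 1 := by
  filter_upwards [ae_restrict_mem measurableSet_Ioi] with x hx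
  exact ⟨(Real.exp_pos _).le, Real.exp_le_one_iff.2 (by linarith [Set.mem_Ioi.1 hx])⟩

lemma exp_int [IsProbabilityMeasure gr] (hpos : ∀ᵐ x ∂gr, 0 ≤ x) {s : ℝ} (hs : 0 ≤ s) :
    Integrable (fun x => Real.exp (-(s * x))) gr := by
  refine Integrable.of_bound (C := 1) (by fun_prop) ?_
  filter_upwards [T_gr hpos hs] with x hx
  rw [Real.norm_of_nonneg hx.1]; exact hx.2

/-- step one: integer multiples -/
lemma t1 [IsProbabilityMeasure gr]
    (hL : Tendsto (fun s : ℝ => s ^ (-α) * (1 - ∫ x, Real.exp (-(s * x)) ∂gr)) (𝓝[>] 0)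
      (𝓝 (c * wJ α))) (n : ℕ) :
    Tendsto (fun s : ℝ => s ^ (-α) * (1 - ∫ x, Real.exp (-((n * s) * x)) ∂gr)) (𝓝[>] 0)
      (𝓝 (c * ∫ y in Set.Ioi (0:ℝ), (1 - Real.exp (-(n * y))) * ww α y)) := by
  rcases Nat.eq_zero_or_pos n with rfl | hn
  · simp
  have hn0 : (0:ℝ) < n := by exact_mod_cast hn
  rw [ww_scale hn0 le_rfl, mul_zero]
  have h0 : Tendsto (fun s : ℝ => n * s) (𝓝[>] 0) (𝓝[>] 0) := by
    refine tendsto_nhdsWithin_iff.2 ⟨?_, ?_⟩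
    · have : Tendsto (fun s : ℝ => n * s) (𝓝 0) (𝓝 (n * 0)) := by
        apply Continuous.tendsto; fun_prop
      rw [mul_zero] at this
      exact this.mono_left nhdsWithin_le_nhds
    · filter_upwards [self_mem_nhdsWithin] with s hs
      exact mul_pos hn0 hs
  have h1 := (hL.comp h0).const_mul ((n:ℝ) ^ α)
  have e : c * ((n:ℝ) ^ α * ∫ z in Set.Ioi (0:ℝ), (1 - Real.exp (-z)) * ww α z)
    = (n:ℝ) ^ α * (c * wJ α) := by unfold wJ; ring
  rw [e]
  refine h1.congr' ?_
  filter_upwards [self_mem_nhdsWithin] with s hs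
  have hs0 : (0:ℝ) < s := hs
  simp only [Function.comp]
  rw [Real.mul_rpow hn0.le hs0.le]
  have : (n:ℝ) ^ α * (n:ℝ) ^ (-α) = 1 := by rw [← Real.rpow_add hn0]; simp
  linear_combination (s ^ (-α) * (1 - ∫ x, Real.exp (-((n * s) * x)) ∂gr)) * this

/-- step two: monomials -/
lemma t2 (hα : 0 < α) (hα1 : α < 1) [IsProbabilityMeasure gr] (hpos : ∀ᵐ x ∂gr, 0 ≤ x)
    (hL : Tendsto (fun s : ℝ => s ^ (-α) * (1 - ∫ x, Real.exp (-(s * x)) ∂gr)) (𝓝[>] 0)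
      (𝓝 (c * wJ α))) (n : ℕ) :
    Tendsto (fun s : ℝ => s ^ (-α) * ∫ x, (1 - Real.exp (-(s * x))) * Real.exp (-(s * x)) ^ n ∂gr)
      (𝓝[>] 0)
      (𝓝 (c * ∫ y in Set.Ioi (0:ℝ), ((1 - Real.exp (-y)) * ww α y) * Real.exp (-y) ^ n)) := by
  have h := (t1 hL (n+1)).sub (t1 hL n)
  have hint : ∀ m : ℕ, IntegrableOn (fun y => (1 - Real.exp (-(m * y))) * ww α y)
      (Set.Ioi (0:ℝ)) := by
    intro m
    rcases Nat.eq_zero_or_pos m with rfl | hm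
    · simp
    · exact ww_scale_int hα hα1 (by exact_mod_cast hm)
  have e : ∀ (m : ℕ) (z : ℝ), Real.exp (-z) ^ m = Real.exp (-(m * z)) := fun m z => by
    rw [← Real.exp_nat_mul]; ring_nf
  have e2 : c * ∫ y in Set.Ioi (0:ℝ), ((1 - Real.exp (-y)) * ww α y) * Real.exp (-y) ^ n
     = c * (∫ y in Set.Ioi (0:ℝ), (1 - Real.exp (-((n+1 : ℕ) * y))) * ww α y)
      - c * ∫ y in Set.Ioi (0:ℝ), (1 - Real.exp (-(n * y))) * ww α y := by
    rw [← mul_sub, ← integral_sub (hint _) (hint _)]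
    congr 2
    ext y
    rw [← e, ← e, pow_succ]; ring
  rw [e2]
  refine h.congr' ?_
  filter_upwards [self_mem_nhdsWithin] with s hs
  have hs0 : (0:ℝ) < s := hs
  rw [← mul_sub, sub_sub_sub_cancel_left, ← integral_sub (exp_int hpos (by positivity))
    (exp_int hpos (by positivity))]
  congr 2
  ext x
  rw [mul_assoc, mul_assoc, ← e, ← e, pow_succ]; ring

/-- step three: polynomials -/
lemma t3 (hα : 0 < α) (hα1 : α < 1) [IsProbabilityMeasure gr] (hpos : ∀ᵐ x ∂gr, 0 ≤ x)
    (hL : Tendsto (fun s : ℝ => s ^ (-α) * (1 - ∫ x, Real.exp (-(s * x)) ∂gr)) (𝓝[>] 0)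
      (𝓝 (c * wJ α))) (p : Polynomial ℝ) :
    Tendsto (fun s : ℝ => s ^ (-α) * ∫ x, (1 - Real.exp (-(s * x))) * p.eval (Real.exp (-(s * x))) ∂gr)
      (𝓝[>] 0)
      (𝓝 (c * ∫ y in Set.Ioi (0:ℝ), ((1 - Real.exp (-y)) * ww α y) * p.eval (Real.exp (-y)))) := by
  induction p using Polynomial.induction_on' with
  | add p q hp hq =>
    have h := hp.add hq
    rw [← mul_add, ← integral_add (W_int (wJ_int hα hα1) (by fun_prop) T_vol p.continuous)
      (W_int (wJ_int hα hα1) (by fun_prop) T_vol q.continuous)] at h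
    simp only [← mul_add, ← Polynomial.eval_add] at h
    refine h.congr' ?_
    filter_upwards [self_mem_nhdsWithin] with s hs
    have hs0 : (0:ℝ) < s := hs
    have hW : Integrable (fun x => 1 - Real.exp (-(s * x))) gr :=
      (integrable_const 1).sub (exp_int hpos hs0.le)
    rw [← integral_add (W_int hW (by fun_prop) (T_gr hpos hs0.le) p.continuous)
      (W_int hW (by fun_prop) (T_gr hpos hs0.le) q.continuous)]
    simp only [← mul_add, ← Polynomial.eval_add]
  | monomial n a =>
    have h := (t2 hα hα1 hpos hL n).const_mul a
    simp only [Polynomial.eval_monomial]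
    convert h using 2
    · rw [mul_left_comm]; congr 1; rw [← integral_const_mul]; congr 1; ext x; ring
    · rw [mul_left_comm]; congr 1; rw [← integral_const_mul]; congr 1; ext x; ring

/-- step four: continuous functions -/
lemma t4 (hα : 0 < α) (hα1 : α < 1) [IsProbabilityMeasure gr] (hpos : ∀ᵐ x ∂gr, 0 ≤ x)
    (hL : Tendsto (fun s : ℝ => s ^ (-α) * (1 - ∫ x, Real.exp (-(s * x)) ∂gr)) (𝓝[>] 0)
      (𝓝 (c * wJ α))) (hc : 0 ≤ c) {q : ℝ → ℝ} (hq : Continuous q) :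
    Tendsto (fun s : ℝ => s ^ (-α) * ∫ x, (1 - Real.exp (-(s * x))) * q (Real.exp (-(s * x))) ∂gr)
      (𝓝[>] 0)
      (𝓝 (c * ∫ y in Set.Ioi (0:ℝ), ((1 - Real.exp (-y)) * ww α y) * q (Real.exp (-y)))) := by
  have hJ : 0 ≤ wJ α := setIntegral_nonneg measurableSet_Ioi fun z hz => J_nonneg_on hα hz
  set D := c * wJ α with hD
  have hD0 : 0 ≤ D := mul_nonneg hc hJ
  rw [Metric.tendsto_nhds]
  intro η hη
  set ε := η / (3 * (D + 1)) with hε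
  have hε0 : 0 < ε := by positivity
  have hεD : ε * (D + 1) = η / 3 := by rw [hε]; field_simp
  obtain ⟨p, hp⟩ := exists_polynomial_near_of_continuousOn 0 1 q hq.continuousOn ε hε0
  have h3 := (Metric.tendsto_nhds.1 (t3 hα hα1 hpos hL p)) (η/3) (by positivity)
  have hB := W_close (wJ_int hα hα1)
    (by filter_upwards [ae_restrict_mem measurableSet_Ioi] with z hz using J_nonneg_on hα hz)
    (by fun_prop) T_vol hq p.continuous hp
  filter_upwards [h3, self_mem_nhdsWithin, hL.eventually (gt_mem_nhds (lt_add_one D))] with s h3 hs hs1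
  have hs0 : (0:ℝ) < s := hs
  have hW : Integrable (fun x => 1 - Real.exp (-(s * x))) gr :=
      (integrable_const 1).sub (exp_int hpos hs0.le)
  have hA := W_close hW
    (by filter_upwards [T_gr hpos hs0.le] with x hx using sub_nonneg.2 hx.2)
    (by fun_prop) (T_gr hpos hs0.le) hq p.continuous hp
  rw [integral_sub (integrable_const 1) (exp_int hpos hs0.le)] at hA
  simp only [integral_const, probReal_univ, smul_eq_mul, one_mul] at hA
  have hsp : 0 < s ^ (-α) := Real.rpow_pos_of_pos hs0 _
  rw [Real.dist_eq] at h3 ⊢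
  change _ ≤ ε * wJ α at hB
  set Ap := ∫ x, (1 - Real.exp (-(s * x))) * p.eval (Real.exp (-(s * x))) ∂gr
  set Aq := ∫ x, (1 - Real.exp (-(s * x))) * q (Real.exp (-(s * x))) ∂gr
  set Bp := ∫ y in Set.Ioi (0:ℝ), ((1 - Real.exp (-y)) * ww α y) * p.eval (Real.exp (-y))
  set Bq := ∫ y in Set.Ioi (0:ℝ), ((1 - Real.exp (-y)) * ww α y) * q (Real.exp (-y))
  have a1 : |s ^ (-α) * Ap - s ^ (-α) * Aq| ≤ η / 3 := by
    rw [← mul_sub, abs_mul, abs_of_pos hsp, ← hεD]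
    calc _ ≤ s ^ (-α) * (ε * (1 - ∫ x, Real.exp (-(s * x)) ∂gr)) :=
          mul_le_mul_of_nonneg_left hA hsp.le
      _ = ε * (s ^ (-α) * (1 - ∫ x, Real.exp (-(s * x)) ∂gr)) := by ring
      _ ≤ _ := mul_le_mul_of_nonneg_left hs1.le hε0.le
  have a2 : |c * Bp - c * Bq| ≤ η / 3 := by
    rw [← mul_sub, abs_mul, abs_of_nonneg hc, ← hεD]
    calc _ ≤ c * (ε * wJ α) := mul_le_mul_of_nonneg_left hB hc
      _ = ε * D := by rw [hD]; ring
      _ ≤ _ := mul_le_mul_of_nonneg_left (by linarith) hε0.le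
  rw [abs_le] at a1 a2
  rw [abs_lt] at h3 ⊢
  constructor <;> linarith [a1.1, a1.2, a2.1, a2.2, h3.1, h3.2]

lemma t5 (hα : 0 < α) (hα1 : α < 1) [IsProbabilityMeasure gr] (hpos : ∀ᵐ x ∂gr, 0 ≤ x)
    (hL : Tendsto (fun s : ℝ => s ^ (-α) * (1 - ∫ x, Real.exp (-(s * x)) ∂gr)) (𝓝[>] 0)
      (𝓝 (c * wJ α))) (hc : 0 ≤ c) {A B : ℝ} (hB : 0 < B) (hAB : B < A) :
    ∃ (l : ℝ) (f : ℝ → ℝ), c * A ^ (-α) ≤ l ∧ l ≤ c * B ^ (-α) ∧ Tendsto f (𝓝[>] 0) (𝓝 l) ∧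
      ∀ s, 0 < s → s ^ (-α) * gr.real (Set.Ioi (A / s)) ≤ f s ∧
        f s ≤ s ^ (-α) * gr.real (Set.Ioi (B / s)) := by
  set a := Real.exp (-A) with ha
  set b := Real.exp (-B) with hb
  have hab : a < b := Real.exp_lt_exp.2 (by linarith)
  have hb1 : b < 1 := by
    rw [hb, ← Real.exp_zero]; exact Real.exp_lt_exp.2 (by linarith)
  set φ : ℝ → ℝ := fun t => max 0 (min 1 ((b - t) / (b - a))) with hφ
  have hφc : Continuous φ := by fun_prop
  have hφ0 : ∀ t, 0 ≤ φ t := fun t => le_max_left _ _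
  have hφ1 : ∀ t, φ t ≤ 1 := fun t => max_le zero_le_one (min_le_left _ _)
  have hφa : ∀ t, t ≤ a → φ t = 1 := fun t ht => by
    have : 1 ≤ (b - t) / (b - a) := by rw [le_div_iff₀ (by linarith)]; linarith
    simp [hφ, min_eq_left this]
  have hφb : ∀ t, b ≤ t → φ t = 0 := fun t ht => by
    have : (b - t) / (b - a) ≤ 0 := div_nonpos_of_nonpos_of_nonneg (by linarith) (by linarith)
    simp only [hφ]
    exact max_eq_left ((min_le_right _ _).trans this)
  have hmx : ∀ t, 0 < max (1 - t) (1 - b) := fun t => lt_max_of_lt_right (by linarith)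
  have hq : Continuous (fun t => φ t / max (1 - t) (1 - b)) :=
    hφc.div (by fun_prop) fun t => (hmx t).ne'
  have hqφ : ∀ t, (1 - t) * (φ t / max (1 - t) (1 - b)) = φ t := fun t => by
    rcases le_total b t with h | h
    · simp [hφb t h]
    · rw [max_eq_left (by linarith)]
      have : (1 - t) ≠ 0 := by linarith
      field_simp
  have h4 := t4 hα hα1 hpos hL hc hq
  have e1 : ∀ y, (1 - Real.exp (-y)) * ww α y *
      (φ (Real.exp (-y)) / max (1 - Real.exp (-y)) (1 - b)) = φ (Real.exp (-y)) * ww α y := by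
    intro y
    conv_rhs => rw [← hqφ]
    ring
  have hi := W_int (wJ_int hα hα1) (T := fun y => Real.exp (-y)) (by fun_prop) T_vol hq
  simp only [hqφ, e1] at h4 hi
  refine ⟨_, _, ?_, ?_, h4, ?_⟩
  · refine mul_le_mul_of_nonneg_left ?_ hc
    have hA : 0 < A := hB.trans hAB
    rw [← ww_tail hα hA]
    calc _ = ∫ y in Set.Ioi A, φ (Real.exp (-y)) * ww α y := by
          refine setIntegral_congr_fun measurableSet_Ioi fun y hy => ?_
          rw [hφa, one_mul]
          exact Real.exp_le_exp.2 (by linarith [Set.mem_Ioi.1 hy])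
      _ ≤ _ := by
          refine setIntegral_mono_set hi ?_ (Set.Ioi_subset_Ioi hA.le).eventuallyLE
          filter_upwards [ae_restrict_mem measurableSet_Ioi] with z hz
          exact mul_nonneg (hφ0 _) (ww_nonneg hα (Set.mem_Ioi.1 hz).le)
  · refine mul_le_mul_of_nonneg_left ?_ hc
    rw [← ww_tail hα hB]
    calc _ = ∫ y in Set.Ioi B, φ (Real.exp (-y)) * ww α y := by
          refine setIntegral_eq_of_subset_of_forall_sdiff_eq_zero measurableSet_Ioi
            (Set.Ioi_subset_Ioi hB.le) fun y hy => ?_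
          rw [hφb, zero_mul]
          exact Real.exp_le_exp.2 (by have := hy.2; simp at this; linarith)
      _ ≤ _ := by
          refine setIntegral_mono_on (IntegrableOn.mono_set hi (Set.Ioi_subset_Ioi hB.le)) (ww_int_tail hα hB)
            measurableSet_Ioi fun y hy => ?_
          have := ww_nonneg hα (hB.trans hy).le
          nlinarith [hφ1 (Real.exp (-y))]
  · intro s hs
    have hsp : 0 < s ^ (-α) := Real.rpow_pos_of_pos hs _
    have hφi : Integrable (fun x => φ (Real.exp (-(s * x)))) gr := by
      refine Integrable.of_bound (C := 1) (by fun_prop) (ae_of_all _ fun x => ?_)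
      rw [Real.norm_of_nonneg (hφ0 _)]; exact hφ1 _
    have hind : ∀ t : ℝ, Integrable ((Set.Ioi t).indicator (fun _ => (1:ℝ))) gr :=
      fun t => (integrable_const 1).indicator measurableSet_Ioi
    constructor
    · refine mul_le_mul_of_nonneg_left ?_ hsp.le
      rw [← integral_indicator_one measurableSet_Ioi]
      refine integral_mono (hind _) hφi fun x => ?_
      by_cases hx : x ∈ Set.Ioi (A / s)
      · rw [Set.indicator_of_mem hx, hφa]; simp
        rw [Set.mem_Ioi, div_lt_iff₀ hs] at hx
        exact Real.exp_le_exp.2 (by linarith)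
      · rw [Set.indicator_of_notMem hx]; exact hφ0 _
    · refine mul_le_mul_of_nonneg_left ?_ hsp.le
      rw [← integral_indicator_one measurableSet_Ioi]
      refine integral_mono hφi (hind _) fun x => ?_
      by_cases hx : x ∈ Set.Ioi (B / s)
      · rw [Set.indicator_of_mem hx]; exact hφ1 _
      · rw [Set.indicator_of_notMem hx]
        rw [Set.mem_Ioi, div_lt_iff₀ hs, not_lt] at hx
        refine (hφb _ (Real.exp_le_exp.2 (by linarith))).le

lemma tauber (hα : 0 < α) (hα1 : α < 1) [IsProbabilityMeasure gr] (hpos : ∀ᵐ x ∂gr, 0 ≤ x)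
    (hL : Tendsto (fun s : ℝ => s ^ (-α) * (1 - ∫ x, Real.exp (-(s * x)) ∂gr)) (𝓝[>] 0)
      (𝓝 (c * wJ α))) (hc : 0 ≤ c) :
    Tendsto (fun x : ℝ => x ^ α * (gr (Set.Ioi x)).toReal) atTop (𝓝 c) := by
  have h1 : Tendsto (fun s : ℝ => s ^ (-α) * gr.real (Set.Ioi (1 / s))) (𝓝[>] 0) (𝓝 c) := by
    have hcont : Tendsto (fun A : ℝ => c * A ^ (-α)) (𝓝 1) (𝓝 c) := by
      have : Tendsto (fun A : ℝ => c * A ^ (-α)) (𝓝 1) (𝓝 (c * 1 ^ (-α))) :=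
        (Real.continuousAt_rpow_const 1 (-α) (Or.inl one_ne_zero)).tendsto.const_mul c
      simpa using this
    rw [tendsto_order]
    constructor
    · intro L hLc
      have := (hcont.mono_left (nhdsWithin_le_nhds (s := Set.Ioi 1))).eventually (lt_mem_nhds hLc)
      obtain ⟨A, hA1, hA⟩ := (this.and self_mem_nhdsWithin).exists
      obtain ⟨l, f, hl1, hl2, hf, hs⟩ := t5 hα hα1 hpos hL hc one_pos (Set.mem_Ioi.1 hA)
      filter_upwards [hf.eventually (lt_mem_nhds (hA1.trans_le hl1)), self_mem_nhdsWithin] with s h1 h2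
      exact h1.trans_le (hs s h2).2
    · intro L hLc
      have := (hcont.mono_left (nhdsWithin_le_nhds (s := Set.Iio 1))).eventually (gt_mem_nhds hLc)
      obtain ⟨B, hB1, hB, hB0⟩ := (this.and (Ioo_mem_nhdsLT (zero_lt_one (α := ℝ)))).exists
      obtain ⟨l, f, hl1, hl2, hf, hs⟩ := t5 hα hα1 hpos hL hc hB hB0
      filter_upwards [hf.eventually (gt_mem_nhds (hl2.trans_lt hB1)), self_mem_nhdsWithin] with s h1 h2
      exact (hs s h2).1.trans_lt h1
  refine (h1.comp tendsto_inv_atTop_nhdsGT_zero).congr' ?_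
  filter_upwards [eventually_gt_atTop 0] with x hx
  simp only [Function.comp, one_div, inv_inv, Measure.real]
  rw [Real.inv_rpow hx.le, Real.rpow_neg hx.le, inv_inv]

end Tauber

/-- **Pareto rainfall gives power-law tails of the invariant outlet discharge.**
If `P_1 ~ Pareto(α, k)` with `0 < α < 1`, `k > 0`, and `d_α = ∫_0^1 M_r(u)^α/u du < ∞`,
then `lim_{x→∞} x^α · g_r((x,∞)) = (λ k^α/H_r) · d_α`. -/
theorem invariant_tail_pareto
    (lam Hr : ℝ) (hlam : 0 < lam) (hHr : 0 < Hr)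
    (Mr : ℝ → ℝ) (hMr_meas : Measurable Mr)
    (hMr_nonneg : ∀ u ∈ Set.Icc (0:ℝ) 1, 0 ≤ Mr u)
    (hMr_bdd : ∃ C : ℝ, ∀ u ∈ Set.Icc (0:ℝ) 1, Mr u ≤ C)
    (hMr_int : IntegrableOn (fun u => Mr u / u) (Set.Ioc (0:ℝ) 1))
    (α k : ℝ) (hα : 0 < α) (hα1 : α < 1) (hk : 0 < k)
    (μP : Measure ℝ) (hμP : μP = ProbabilityTheory.paretoMeasure k α)
    (hdα : IntegrableOn (fun u => (Mr u) ^ α / u) (Set.Ioc (0:ℝ) 1))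
    (gr : Measure ℝ) [IsProbabilityMeasure gr] (hgr : gr (Set.Ici (0:ℝ)) = 1)
    (hgrLaplace : ∀ s : ℝ, 0 ≤ s →
      ∫ x, Real.exp (-(s * x)) ∂gr
        = Real.exp (-(lam / Hr * ∫ u in Set.Ioc (0:ℝ) 1,
            (1 - ∫ y, Real.exp (-(Mr u * s * y)) ∂μP) / u))) :
    Tendsto (fun x : ℝ => x ^ α * (gr (Set.Ioi x)).toReal) atTop
      (𝓝 (lam * k ^ α / Hr * ∫ u in Set.Ioc (0:ℝ) 1, (Mr u) ^ α / u)) := by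
  subst hμP
  have hpos : ∀ᵐ x ∂gr, 0 ≤ x := (prob_compl_eq_zero_iff measurableSet_Ici).2 hgr
  refine tauber hα hα1 hpos ?_ ?_
  · have := one_sub_exp_lim hα (abel (lam := lam) (Hr := Hr) hMr_meas hMr_nonneg hα hα1 hk hdα)
    refine this.congr' ?_
    filter_upwards [self_mem_nhdsWithin] with s hs
    rw [hgrLaplace s (Set.mem_Ioi.1 hs).le]
  · refine mul_nonneg (by positivity) (setIntegral_nonneg measurableSet_Ioc fun u hu => ?_)
    exact div_nonneg (Real.rpow_nonneg (hMr_nonneg u ⟨hu.1.le, hu.2⟩) _) hu.1.le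

end
end

section
/- Suppose μ_P is the Exponential(σ) distribution for some σ > 0 (density σ·e^{−σy} for y > 0). Suppose in addition that M_r is continuous on [0,1], that M* := max_{u∈[0,1]} M_r(u) > 0 is attained at some point u* ∈ (0,1), and that M_r is differentiable at u*. Then the invariant outlet-discharge distribution has exponential tail decay: lim_{x→∞} (1/x)·log g_r((x,∞)) = −σ/M*. -/
open MeasureTheory Filter Topology

noncomputable section

lemma laplace_ext (ρ₁ ρ₂ : Measure ℝ)
    (h : ∀ s : ℝ, 0 < s → ∫⁻ x, ENNReal.ofReal (Real.exp (-(s * x))) ∂ρ₁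
      = ∫⁻ x, ENNReal.ofReal (Real.exp (-(s * x))) ∂ρ₂)
    (hfin : ∀ s : ℝ, 0 < s → ∫⁻ x, ENNReal.ofReal (Real.exp (-(s * x))) ∂ρ₂ ≠ ⊤) :
    ρ₁ = ρ₂ := by
  set d : ℝ → ENNReal := fun x => ENNReal.ofReal (Real.exp (-x)) with hd
  have hdm : Measurable d := by fun_prop
  have hd0 : ∀ x, d x ≠ 0 := fun x => by simp [hd, Real.exp_pos]
  have hdt : ∀ x, d x ≠ ⊤ := fun x => by simp [hd]
  have key : ∀ ρ : Measure ℝ,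
      (∀ s : ℝ, 0 < s → ∫⁻ x, ENNReal.ofReal (Real.exp (-(s * x))) ∂ρ ≠ ⊤) →
      IsFiniteMeasure (ρ.withDensity d) ∧
      (∀ t < 1, Integrable (fun x => Real.exp (t * x)) (ρ.withDensity d) ∧
        ∫ x, Real.exp (t * x) ∂(ρ.withDensity d)
          = (∫⁻ x, ENNReal.ofReal (Real.exp (-((1 - t) * x))) ∂ρ).toReal) := by
    intro ρ hρ
    have e : ∀ t : ℝ, ∫⁻ x, ENNReal.ofReal (Real.exp (t * x)) ∂(ρ.withDensity d)
        = ∫⁻ x, ENNReal.ofReal (Real.exp (-((1 - t) * x))) ∂ρ := by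
      intro t
      rw [lintegral_withDensity_eq_lintegral_mul _ hdm (by fun_prop)]
      refine lintegral_congr fun x => ?_
      simp only [hd, Pi.mul_apply]
      rw [← ENNReal.ofReal_mul (Real.exp_pos _).le, ← Real.exp_add]
      ring_nf
    constructor
    · constructor
      rw [withDensity_apply _ MeasurableSet.univ, Measure.restrict_univ, lt_top_iff_ne_top]
      simpa [hd] using hρ 1 one_pos
    · intro t ht
      constructor
      · refine (lintegral_ofReal_ne_top_iff_integrable (by fun_prop) ?_).1 ?_
        · exact Eventually.of_forall fun x => (Real.exp_pos _).le
        · rw [e]; exact hρ _ (by linarith)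
      · rw [integral_eq_lintegral_of_nonneg_ae
          (Eventually.of_forall fun x => (Real.exp_pos _).le) (by fun_prop), e]
  obtain ⟨f1, k1⟩ := key ρ₁ (fun s hs => by rw [h s hs]; exact hfin s hs)
  obtain ⟨f2, k2⟩ := key ρ₂ hfin
  have sub : ∀ ρ : Measure ℝ, (∀ t < 1, Integrable (fun x => Real.exp (t * x)) ρ) →
      {z : ℂ | z.re < 1} ⊆ {z | z.re ∈ interior (ProbabilityTheory.integrableExpSet id ρ)} := by
    intro ρ hρ z hz
    have : Set.Iio (1:ℝ) ⊆ interior (ProbabilityTheory.integrableExpSet id ρ) :=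
      interior_maximal (fun t ht => hρ t ht) isOpen_Iio
    exact this hz
  have a1 := (ProbabilityTheory.analyticOnNhd_complexMGF (X := id)
    (μ := ρ₁.withDensity d)).mono (sub _ fun t ht => (k1 t ht).1)
  have a2 := (ProbabilityTheory.analyticOnNhd_complexMGF (X := id)
    (μ := ρ₂.withDensity d)).mono (sub _ fun t ht => (k2 t ht).1)
  have hpre : IsPreconnected {z : ℂ | z.re < 1} :=
    ((convex_Iio (1:ℝ)).linear_preimage Complex.reLm).isPreconnected
  have heq : Set.EqOn _ _ _ := AnalyticOnNhd.eqOn_of_preconnected_of_frequently_eq a1 a2 hpre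
    (z₀ := ((0:ℝ) : ℂ)) (by simp) (by
      have h_real : ∃ᶠ (x : ℝ) in 𝓝[≠] 0,
          ProbabilityTheory.complexMGF id (ρ₁.withDensity d) x
            = ProbabilityTheory.complexMGF id (ρ₂.withDensity d) x := by
        refine Eventually.frequently ?_
        have : ∀ᶠ x : ℝ in 𝓝[≠] 0, x < 1 :=
          nhdsWithin_le_nhds (Iio_mem_nhds one_pos)
        filter_upwards [this] with y hy
        rw [ProbabilityTheory.complexMGF_ofReal, ProbabilityTheory.complexMGF_ofReal]
        congr 1
        simp only [ProbabilityTheory.mgf, id]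
        rw [(k1 y hy).2, (k2 y hy).2, h _ (by linarith)]
      rw [frequently_iff_seq_forall] at h_real ⊢
      obtain ⟨xs, hx_tendsto, hx_eq⟩ := h_real
      refine ⟨fun n ↦ xs n, ?_, fun n ↦ ?_⟩
      · rw [tendsto_nhdsWithin_iff] at hx_tendsto ⊢
        constructor
        · exact (Complex.continuous_ofReal.tendsto _).comp hx_tendsto.1
        · simpa using hx_tendsto.2
      · simp [hx_eq])
  have hfinal : ρ₁.withDensity d = ρ₂.withDensity d := by
    apply Measure.ext_of_charFun
    funext t
    rw [← ProbabilityTheory.complexMGF_id_mul_I, ← ProbabilityTheory.complexMGF_id_mul_I]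
    exact heq (by simp)
  rw [← withDensity_inv_same hdm (Eventually.of_forall hd0) (Eventually.of_forall hdt) (μ := ρ₁),
    hfinal, withDensity_inv_same hdm (Eventually.of_forall hd0) (Eventually.of_forall hdt)]

/-- Density of the size-biased Lévy measure. -/
def kd (c σ : ℝ) (M : ℝ → ℝ) (y : ℝ) : ENNReal :=
  ∫⁻ u in Set.Ioc (0:ℝ) 1, ENNReal.ofReal (c / u * (σ * y / M u) * Real.exp (-(σ * y / M u)))

def kM (c σ : ℝ) (M : ℝ → ℝ) : Measure ℝ :=
  (volume.restrict (Set.Ioi (0:ℝ))).withDensity (kd c σ M)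

lemma kd_meas (c σ : ℝ) (M : ℝ → ℝ) (hM : Measurable M) : Measurable (kd c σ M) := by
  unfold kd
  apply Measurable.lintegral_prod_right'
    (f := fun p : ℝ × ℝ => ENNReal.ofReal (c / p.2 * (σ * p.1 / M p.2) * Real.exp (-(σ * p.1 / M p.2))))
  fun_prop

lemma int_y_exp (a : ℝ) (ha : 0 < a) :
    ∫⁻ y in Set.Ioi (0:ℝ), ENNReal.ofReal (y * Real.exp (-(a * y))) = ENNReal.ofReal (1 / a ^ 2) := by
  have h := Real.integral_rpow_mul_exp_neg_mul_Ioi (a := 2) (r := a) two_pos ha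
  have hE : Real.Gamma 2 = 1 := Real.Gamma_two
  have e : ∀ t : ℝ, t ^ ((2:ℝ) - 1) * Real.exp (-(a * t)) = t * Real.exp (-(a * t)) := by
    intro t; norm_num
  simp only [e, hE, mul_one] at h
  have h2 : (1 / a) ^ (2:ℝ) = 1 / a ^ 2 := by
    rw [show (2:ℝ) = ((2:ℕ):ℝ) by norm_num, Real.rpow_natCast, div_pow, one_pow]
  rw [h2] at h
  rw [← h, ofReal_integral_eq_lintegral_ofReal]
  · by_contra hn
    have := integral_undef hn
    rw [h] at this
    have : 0 < 1 / a ^ 2 := by positivity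
    linarith
  · filter_upwards [ae_restrict_mem measurableSet_Ioi] with y hy
    exact mul_nonneg (le_of_lt hy) (Real.exp_pos _).le

lemma kM_laplace (c σ : ℝ) (hc : 0 < c) (hσ : 0 < σ) (M : ℝ → ℝ) (hM : Measurable M)
    (hM0 : ∀ u ∈ Set.Icc (0:ℝ) 1, 0 ≤ M u) (s : ℝ)
    (hs : ∀ u ∈ Set.Icc (0:ℝ) 1, 0 < σ + M u * s) :
    ∫⁻ y, ENNReal.ofReal (Real.exp (-(s * y))) ∂(kM c σ M)
      = ∫⁻ u in Set.Ioc (0:ℝ) 1, ENNReal.ofReal (c * (σ * (M u / u) / (σ + M u * s) ^ 2)) := by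
  unfold kM
  rw [lintegral_withDensity_eq_lintegral_mul _ (kd_meas c σ M hM) (by fun_prop)]
  simp only [Pi.mul_apply, kd]
  have e1 : ∀ y : ℝ, (∫⁻ u in Set.Ioc (0:ℝ) 1,
      ENNReal.ofReal (c / u * (σ * y / M u) * Real.exp (-(σ * y / M u))))
        * ENNReal.ofReal (Real.exp (-(s * y)))
      = ∫⁻ u in Set.Ioc (0:ℝ) 1,
      ENNReal.ofReal (c / u * (σ * y / M u) * Real.exp (-(σ * y / M u)))
        * ENNReal.ofReal (Real.exp (-(s * y))) := by
    intro y
    rw [lintegral_mul_const _ (by fun_prop)]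
  simp only [e1]
  rw [lintegral_lintegral_swap (by unfold Function.uncurry; fun_prop)]
  refine setLIntegral_congr_fun measurableSet_Ioc fun u hu => ?_
  have huI : u ∈ Set.Icc (0:ℝ) 1 := ⟨hu.1.le, hu.2⟩
  have hu0 := hu.1
  have hsu := hs u huI
  rcases (hM0 u huI).eq_or_lt with h0 | hpos
  · simp [← h0]
  · have e2 : ∀ y : ℝ, ENNReal.ofReal (c / u * (σ * y / M u) * Real.exp (-(σ * y / M u)))
        * ENNReal.ofReal (Real.exp (-(s * y)))
        = ENNReal.ofReal (c / u * (σ / M u)) *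
          ENNReal.ofReal (y * Real.exp (-(((σ + M u * s) / M u) * y))) := by
      intro y
      rw [← ENNReal.ofReal_mul' (Real.exp_pos _).le, ← ENNReal.ofReal_mul (by positivity)]
      congr 1
      have : -(((σ + M u * s) / M u) * y) = -(σ * y / M u) + -(s * y) := by
        field_simp; ring
      rw [this, Real.exp_add]; ring
    simp only [e2]
    rw [lintegral_const_mul _ (by fun_prop), int_y_exp _ (by positivity),
      ← ENNReal.ofReal_mul (by positivity)]
    congr 1
    field_simp

lemma exp_laplace (σ t : ℝ) (hσ : 0 < σ) (ht : 0 ≤ t) :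
    ∫ y, Real.exp (-(t * y)) ∂(ProbabilityTheory.expMeasure σ) = σ / (σ + t) := by
  have hpos : 0 < σ + t := by linarith
  unfold ProbabilityTheory.expMeasure ProbabilityTheory.gammaMeasure
  have : ∫ y, Real.exp (-(t * y)) ∂(volume.withDensity (ProbabilityTheory.gammaPDF 1 σ))
      = ∫ y in Set.Ioi 0, σ * Real.exp ((-(σ + t)) * y) := by
    rw [integral_withDensity_eq_integral_toReal_smul
      (by unfold ProbabilityTheory.gammaPDF; exact (ProbabilityTheory.measurable_gammaPDFReal 1 σ).ennreal_ofReal)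
      (Eventually.of_forall fun x => by simp [ProbabilityTheory.gammaPDF]),
      ← integral_Ici_eq_integral_Ioi, ← integral_indicator measurableSet_Ici]
    congr 1
    funext y
    have := ProbabilityTheory.exponentialPDF_eq σ y
    unfold ProbabilityTheory.exponentialPDF ProbabilityTheory.exponentialPDFReal at this
    unfold ProbabilityTheory.gammaPDF
    rw [this]
    by_cases hy : 0 ≤ y
    · rw [Set.indicator_of_mem (by exact hy), if_pos hy, ENNReal.toReal_ofReal (by positivity),
        smul_eq_mul, mul_assoc, ← Real.exp_add]
      ring_nf
    · rw [Set.indicator_of_notMem (by exact hy), if_neg hy]; simp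
  rw [this, integral_const_mul, integral_exp_mul_Ioi (by linarith)]
  rw [mul_zero, Real.exp_zero, neg_div_neg_eq]
  field_simp

lemma laplace_deriv (c σ : ℝ) (hσ : 0 < σ) (M : ℝ → ℝ) (hM : Measurable M)
    (hM0 : ∀ u ∈ Set.Icc (0:ℝ) 1, 0 ≤ M u)
    (hMint : IntegrableOn (fun u => M u / u) (Set.Ioc (0:ℝ) 1))
    (g : Measure ℝ) [IsProbabilityMeasure g] (hg : ∀ᵐ x ∂g, 0 ≤ x)
    (hL : ∀ s : ℝ, 0 ≤ s → ∫ x, Real.exp (-(s * x)) ∂g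
      = Real.exp (-(c * ∫ u in Set.Ioc (0:ℝ) 1,
            (1 - ∫ y, Real.exp (-(M u * s * y)) ∂(ProbabilityTheory.expMeasure σ)) / u)))
    (s : ℝ) (hs : 0 < s) :
    IntegrableOn (fun u => σ * (M u / u) / (σ + M u * s) ^ 2) (Set.Ioc (0:ℝ) 1) ∧
    Integrable (fun x => x * Real.exp (-(s * x))) g ∧
    ∫ x, x * Real.exp (-(s * x)) ∂g = (∫ x, Real.exp (-(s * x)) ∂g) *
      (c * ∫ u in Set.Ioc (0:ℝ) 1, σ * (M u / u) / (σ + M u * s) ^ 2) := by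
  have hint : ∀ t ≤ 0, Integrable (fun x => Real.exp (t * x)) g := by
    intro t ht
    refine Integrable.mono' (integrable_const (1:ℝ)) (by fun_prop) ?_
    filter_upwards [hg] with x hx
    rw [Real.norm_eq_abs, abs_of_pos (Real.exp_pos _), Real.exp_le_one_iff]
    exact mul_nonpos_of_nonpos_of_nonneg ht hx
  have hinter : -s ∈ interior (ProbabilityTheory.integrableExpSet id g) := by
    have : Set.Iio (0:ℝ) ⊆ interior (ProbabilityTheory.integrableExpSet id g) :=
      interior_maximal (fun t ht => hint t (le_of_lt ht)) isOpen_Iio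
    exact this (by simpa using hs)
  have d1 := ProbabilityTheory.hasDerivAt_mgf hinter
  have d1' : HasDerivAt (fun r : ℝ => ProbabilityTheory.mgf id g (-r))
      (-(∫ x, x * Real.exp (-(s * x)) ∂g)) s := by
    have := HasDerivAt.comp s d1 (hasDerivAt_neg s)
    simpa [Function.comp_def] using this
  have hFae : ∀ᵐ u ∂(volume.restrict (Set.Ioc (0:ℝ) 1)), 0 < u ∧ 0 ≤ M u := by
    filter_upwards [ae_restrict_mem measurableSet_Ioc] with u hu
    exact ⟨hu.1, hM0 u ⟨hu.1.le, hu.2⟩⟩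
  have d2 := hasDerivAt_integral_of_dominated_loc_of_deriv_le
    (μ := volume.restrict (Set.Ioc (0:ℝ) 1)) (𝕜 := ℝ) (x₀ := s) (s := Set.Ioi 0)
    (F := fun r u => (M u / u) * (r / (σ + M u * r)))
    (F' := fun r u => σ * (M u / u) / (σ + M u * r) ^ 2)
    (bound := fun u => (M u / u) * (1 / σ))
    (Ioi_mem_nhds hs)
    (Eventually.of_forall fun r => by
      exact Measurable.aestronglyMeasurable (by fun_prop))
    (by
      refine Integrable.mono' (hMint.mul_const (s / σ))
        (Measurable.aestronglyMeasurable (by fun_prop)) ?_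
      filter_upwards [hFae] with u hu
      obtain ⟨h1, h2⟩ := hu
      rw [Real.norm_eq_abs, abs_of_nonneg (by positivity)]
      gcongr
      have : 0 ≤ M u * s := by positivity
      linarith)
    (Measurable.aestronglyMeasurable (by fun_prop))
    (by
      filter_upwards [hFae] with u hu r hr
      obtain ⟨h1, h2⟩ := hu
      have hr : 0 < r := hr
      rw [Real.norm_eq_abs, abs_of_nonneg (by positivity), mul_comm σ, mul_div_assoc]
      refine mul_le_mul_of_nonneg_left ?_ (by positivity)
      rw [div_le_div_iff₀ (by positivity) hσ]
      have : 0 ≤ M u * r := by positivity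
      nlinarith)
    (hMint.mul_const _)
    (by
      filter_upwards [hFae] with u hu r hr
      obtain ⟨h1, h2⟩ := hu
      have hr : 0 < r := hr
      have hp : σ + M u * r ≠ 0 := by positivity
      have := ((hasDerivAt_id r).div (((hasDerivAt_id r).const_mul (M u)).const_add σ) hp).const_mul (M u / u)
      convert! this using 1
      simp only [id]
      field_simp
      ring)
  refine ⟨d2.1, ?_, ?_⟩
  · have := ProbabilityTheory.integrable_pow_mul_exp_of_mem_interior_integrableExpSet hinter 1
    simpa using this
  · have hLs : ∀ r : ℝ, 0 ≤ r → ProbabilityTheory.mgf id g (-r)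
        = Real.exp (-(c * ∫ u in Set.Ioc (0:ℝ) 1, (M u / u) * (r / (σ + M u * r)))) := by
      intro r hr
      have h := hL r hr
      simp only [ProbabilityTheory.mgf, id, neg_mul]
      rw [h]
      congr 3
      refine setIntegral_congr_fun measurableSet_Ioc fun u hu => ?_
      have hMu := hM0 u ⟨hu.1.le, hu.2⟩
      have hu0 := hu.1
      have hp : 0 < σ + M u * r := by positivity
      rw [exp_laplace σ _ hσ (by positivity)]
      field_simp
      ring
    have d3 := ((d2.2.const_mul c).neg).exp
    have d4 : HasDerivAt (fun r : ℝ => ProbabilityTheory.mgf id g (-r)) _ s :=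
      d3.congr_of_eventuallyEq (by
        filter_upwards [Ioi_mem_nhds hs] with r hr
        exact hLs r (le_of_lt hr))
    have := d1'.unique d4
    have h5 := hLs s hs.le
    simp only [ProbabilityTheory.mgf, id, neg_mul] at h5
    rw [h5]
    simp only [Pi.neg_apply] at this
    linarith

lemma steutel (c σ : ℝ) (hc : 0 < c) (hσ : 0 < σ) (M : ℝ → ℝ) (hM : Measurable M)
    (hM0 : ∀ u ∈ Set.Icc (0:ℝ) 1, 0 ≤ M u)
    (hMint : IntegrableOn (fun u => M u / u) (Set.Ioc (0:ℝ) 1))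
    (g : Measure ℝ) [IsProbabilityMeasure g] (hg : ∀ᵐ x ∂g, 0 ≤ x)
    (hL : ∀ s : ℝ, 0 ≤ s → ∫ x, Real.exp (-(s * x)) ∂g
      = Real.exp (-(c * ∫ u in Set.Ioc (0:ℝ) 1,
            (1 - ∫ y, Real.exp (-(M u * s * y)) ∂(ProbabilityTheory.expMeasure σ)) / u))) :
    g.withDensity (fun x => ENNReal.ofReal x) = g.conv (kM c σ M) := by
  have : SFinite (kM c σ M) := by unfold kM; infer_instance
  have right : ∀ s : ℝ, 0 < s → ∫⁻ x, ENNReal.ofReal (Real.exp (-(s * x))) ∂(g.conv (kM c σ M))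
      = ENNReal.ofReal ((∫ x, Real.exp (-(s * x)) ∂g) *
      (c * ∫ u in Set.Ioc (0:ℝ) 1, σ * (M u / u) / (σ + M u * s) ^ 2)) := by
    intro s hs
    obtain ⟨i1, i2, i3⟩ := laplace_deriv c σ hσ M hM hM0 hMint g hg hL s hs
    have hsu : ∀ u ∈ Set.Icc (0:ℝ) 1, 0 < σ + M u * s := by
      intro u hu
      have := hM0 u hu
      positivity
    rw [Measure.lintegral_conv (by fun_prop)]
    have e : ∀ x y : ℝ, ENNReal.ofReal (Real.exp (-(s * (x + y))))
        = ENNReal.ofReal (Real.exp (-(s * x))) * ENNReal.ofReal (Real.exp (-(s * y))) := by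
      intro x y
      rw [← ENNReal.ofReal_mul (Real.exp_pos _).le, ← Real.exp_add]
      ring_nf
    simp only [e]
    simp_rw [lintegral_const_mul _ (show Measurable fun y : ℝ => ENNReal.ofReal (Real.exp (-(s * y))) by fun_prop)]
    rw [lintegral_mul_const _ (by fun_prop), kM_laplace c σ hc hσ M hM hM0 s hsu,
      ENNReal.ofReal_mul (integral_nonneg fun x => (Real.exp_pos _).le)]
    congr 1
    · rw [ofReal_integral_eq_lintegral_ofReal]
      · by_contra hn
        have h0 := hL s hs.le
        rw [integral_undef hn] at h0
        exact (Real.exp_pos _).ne h0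
      · exact Eventually.of_forall fun x => (Real.exp_pos _).le
    · rw [← integral_const_mul, ofReal_integral_eq_lintegral_ofReal (i1.const_mul c)]
      filter_upwards [ae_restrict_mem measurableSet_Ioc] with u hu
      have h1 := hM0 u ⟨hu.1.le, hu.2⟩
      have h2 := hu.1
      positivity
  refine laplace_ext _ _ (fun s hs => ?_) (fun s hs => ?_)
  · obtain ⟨i1, i2, i3⟩ := laplace_deriv c σ hσ M hM hM0 hMint g hg hL s hs
    rw [right s hs, ← i3, lintegral_withDensity_eq_lintegral_mul _ (by fun_prop) (by fun_prop),
      ofReal_integral_eq_lintegral_ofReal i2]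
    · refine lintegral_congr fun x => ?_
      rw [Pi.mul_apply, ENNReal.ofReal_mul' (Real.exp_pos _).le]
    · filter_upwards [hg] with x hx
      exact mul_nonneg hx (Real.exp_pos _).le
  · rw [right s hs]; exact ENNReal.ofReal_ne_top

lemma upper_tail (g k : Measure ℝ) [IsProbabilityMeasure g] [SFinite k]
    (hk : ∀ᵐ y ∂k, 0 ≤ y)
    (hid : g.withDensity (fun x => ENNReal.ofReal x) = g.conv k) (t : ℝ) (ht : 0 < t)
    (hC : ∫⁻ y, ENNReal.ofReal (Real.exp (t * y)) ∂k ≠ ⊤) :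
    ∃ B : ℝ, 0 < B ∧ ∀ x : ℝ, (g (Set.Ioi x)).toReal ≤ B * Real.exp (-(t * x)) := by
  set E : ℝ → ENNReal := fun z => ENNReal.ofReal (Real.exp (t * z)) with hE
  have hEm : Measurable E := by fun_prop
  set C := ∫⁻ y, E y ∂k with hCdef
  set G : ℝ → ENNReal := fun X => ∫⁻ z in Set.Iic X, E z ∂g with hG
  have hGfin : ∀ X, G X ≠ ⊤ := by
    intro X
    refine ne_top_of_le_ne_top (b := ∫⁻ z in Set.Iic X, ENNReal.ofReal (Real.exp (t * X)) ∂g) ?_ ?_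
    · rw [setLIntegral_const]
      exact ENNReal.mul_ne_top ENNReal.ofReal_ne_top (measure_ne_top _ _)
    · refine setLIntegral_mono (by fun_prop) fun z hz => ?_
      refine ENNReal.ofReal_le_ofReal (Real.exp_le_exp.2 ?_)
      exact mul_le_mul_of_nonneg_left hz ht.le
  have h1 : ∀ X, ∫⁻ z in Set.Iic X, ENNReal.ofReal z * E z ∂g ≤ G X * C := by
    intro X
    have e1 : ∫⁻ z in Set.Iic X, ENNReal.ofReal z * E z ∂g
        = ∫⁻ z, (Set.Iic X).indicator E z ∂(g.conv k) := by
      rw [← hid, lintegral_indicator measurableSet_Iic,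
        setLIntegral_withDensity_eq_setLIntegral_mul _ (by fun_prop) hEm measurableSet_Iic]
      rfl
    rw [e1, Measure.lintegral_conv (hEm.indicator measurableSet_Iic)]
    calc ∫⁻ x, ∫⁻ y, (Set.Iic X).indicator E (x + y) ∂k ∂g
        ≤ ∫⁻ x, ∫⁻ y, (Set.Iic X).indicator E x * E y ∂k ∂g := by
          refine lintegral_mono fun x => lintegral_mono_ae ?_
          filter_upwards [hk] with y hy
          by_cases hxy : x + y ≤ X
          · rw [Set.indicator_of_mem (by exact hxy),
              Set.indicator_of_mem (by exact (by linarith : x ≤ X))]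
            simp only [hE]
            rw [← ENNReal.ofReal_mul (Real.exp_pos _).le, ← Real.exp_add, mul_add]
          · rw [Set.indicator_of_notMem (by exact hxy)]
            exact zero_le
      _ = G X * C := by
          simp_rw [lintegral_const_mul _ hEm]
          rw [lintegral_mul_const _ (hEm.indicator measurableSet_Iic),
            lintegral_indicator measurableSet_Iic]
  set a : ℝ := 2 * C.toReal + 1 with ha
  have hC0 : 0 ≤ C.toReal := ENNReal.toReal_nonneg
  have ha0 : 0 < a := by linarith
  have h2 : ∀ X, ENNReal.ofReal a * G X ≤ ENNReal.ofReal a * G a + G X * C := by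
    intro X
    refine le_trans ?_ (add_le_add_right (h1 X) _)
    simp only [hG]
    rw [← lintegral_const_mul _ hEm, ← lintegral_const_mul _ hEm,
      ← lintegral_indicator measurableSet_Iic, ← lintegral_indicator measurableSet_Iic,
      ← lintegral_indicator measurableSet_Iic,
      ← lintegral_add_left ((hEm.const_mul _).indicator measurableSet_Iic)]
    refine lintegral_mono fun z => ?_
    by_cases hzX : z ≤ X
    · by_cases hza : z ≤ a
      · rw [Set.indicator_of_mem (by exact hzX), Set.indicator_of_mem (by exact hza)]
        exact le_self_add
      · rw [Set.indicator_of_mem (by exact hzX), Set.indicator_of_notMem (by exact hza),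
          Set.indicator_of_mem (by exact hzX), zero_add]
        gcongr
        exact (not_le.1 hza).le
    · rw [Set.indicator_of_notMem (by exact hzX)]
      exact zero_le
  have h3 : ∀ X, (G X).toReal ≤ 2 * (G a).toReal := by
    intro X
    have := ENNReal.toReal_mono (ENNReal.add_ne_top.2
      ⟨ENNReal.mul_ne_top ENNReal.ofReal_ne_top (hGfin a), ENNReal.mul_ne_top (hGfin X) hC⟩) (h2 X)
    rw [ENNReal.toReal_add (ENNReal.mul_ne_top ENNReal.ofReal_ne_top (hGfin a))
      (ENNReal.mul_ne_top (hGfin X) hC), ENNReal.toReal_mul, ENNReal.toReal_mul,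
      ENNReal.toReal_mul, ENNReal.toReal_ofReal ha0.le] at this
    have p : 0 ≤ (G X).toReal := ENNReal.toReal_nonneg
    have h4 : a * (G X).toReal ≤ a * (2 * (G a).toReal) := by nlinarith
    exact le_of_mul_le_mul_left h4 ha0
  have hB0 : 0 ≤ (G a).toReal := ENNReal.toReal_nonneg
  have htot : ∫⁻ z, E z ∂g ≤ ENNReal.ofReal (2 * (G a).toReal) := by
    have hcov : AECover g atTop (fun X : ℝ => Set.Iic X) := aecover_Iic tendsto_id
    refine le_of_tendsto' (hcov.lintegral_tendsto_of_countably_generated hEm.aemeasurable) ?_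
    intro X
    change G X ≤ _
    rw [← ENNReal.ofReal_toReal (hGfin X)]
    exact ENNReal.ofReal_le_ofReal (h3 X)
  refine ⟨2 * (G a).toReal + 1, by linarith, fun x => ?_⟩
  have hch := (mul_meas_ge_le_lintegral hEm (μ := g) (E x)).trans htot
  have hsub : g (Set.Ioi x) ≤ g {z | E x ≤ E z} := by
    refine measure_mono fun z hz => ?_
    refine ENNReal.ofReal_le_ofReal (Real.exp_le_exp.2 ?_)
    exact mul_le_mul_of_nonneg_left (le_of_lt hz) ht.le
  have h5 : E x * g (Set.Ioi x) ≤ ENNReal.ofReal (2 * (G a).toReal) :=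
    (mul_le_mul_right hsub _).trans hch
  have h6 := ENNReal.toReal_mono ENNReal.ofReal_ne_top h5
  rw [ENNReal.toReal_mul, ENNReal.toReal_ofReal (Real.exp_pos _).le,
    ENNReal.toReal_ofReal (by linarith)] at h6
  have hp := Real.exp_pos (t * x)
  rw [Real.exp_neg, ← div_eq_mul_inv, le_div_iff₀ hp]
  linarith

lemma lower_tail (g k : Measure ℝ) [IsProbabilityMeasure g] [SFinite k]
    (hid : g.withDensity (fun x => ENNReal.ofReal x) = g.conv k) (A x : ℝ) :
    g (Set.Icc 0 A) * k (Set.Ioc x (x + A)) ≤ ENNReal.ofReal (x + 2 * A) * g (Set.Ioi x) := by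
  have hm : Measurable ((Set.Ioc x (x + 2 * A)).indicator (1 : ℝ → ENNReal)) :=
    measurable_one.indicator measurableSet_Ioc
  calc g (Set.Icc 0 A) * k (Set.Ioc x (x + A))
      = ∫⁻ z, ∫⁻ y, (Set.Icc 0 A).indicator (1 : ℝ → ENNReal) z
          * (Set.Ioc x (x + A)).indicator (1 : ℝ → ENNReal) y ∂k ∂g := by
        simp_rw [lintegral_const_mul _
          ((measurable_one : Measurable (1 : ℝ → ENNReal)).indicator (measurableSet_Ioc (a := x) (b := x + A)))]
        rw [lintegral_mul_const _ (measurable_one.indicator measurableSet_Icc),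
          lintegral_indicator_one measurableSet_Icc, lintegral_indicator_one measurableSet_Ioc]
    _ ≤ ∫⁻ z, ∫⁻ y, (Set.Ioc x (x + 2 * A)).indicator (1 : ℝ → ENNReal) (z + y) ∂k ∂g := by
        refine lintegral_mono fun z => lintegral_mono fun y => ?_
        by_cases hz : z ∈ Set.Icc 0 A
        · by_cases hy : y ∈ Set.Ioc x (x + A)
          · have : z + y ∈ Set.Ioc x (x + 2 * A) :=
              ⟨by linarith [hz.1, hy.1], by linarith [hz.2, hy.2]⟩
            simp [hz, hy, this]
          · simp [hy]
        · simp [hz]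
    _ = (g.withDensity (fun x => ENNReal.ofReal x)) (Set.Ioc x (x + 2 * A)) := by
        rw [← Measure.lintegral_conv hm, lintegral_indicator_one measurableSet_Ioc, hid]
    _ = ∫⁻ z in Set.Ioc x (x + 2 * A), ENNReal.ofReal z ∂g := withDensity_apply _ measurableSet_Ioc
    _ ≤ ∫⁻ z in Set.Ioc x (x + 2 * A), ENNReal.ofReal (x + 2 * A) ∂g :=
        setLIntegral_mono (by fun_prop) fun z hz => ENNReal.ofReal_le_ofReal hz.2
    _ ≤ ENNReal.ofReal (x + 2 * A) * g (Set.Ioi x) := by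
        rw [setLIntegral_const]
        gcongr
        exact fun z hz => hz.1

lemma kM_lower (c σ : ℝ) (hc : 0 < c) (hσ : 0 < σ) (M : ℝ → ℝ) (m Ms p q : ℝ)
    (hm : 0 < m) (hp : 0 ≤ p) (hq : q ≤ 1)
    (hM : ∀ u ∈ Set.Ioc p q, m ≤ M u ∧ M u ≤ Ms) (x A : ℝ) (hx : 0 < x) (hMs : 0 < Ms) :
    ENNReal.ofReal (c * (σ * x / Ms) * Real.exp (-(σ * (x + A) / m))) * ENNReal.ofReal (q - p)
      * ENNReal.ofReal A ≤ kM c σ M (Set.Ioc x (x + A)) := by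
  unfold kM
  rw [withDensity_apply _ measurableSet_Ioc, Measure.restrict_restrict measurableSet_Ioc,
    Set.inter_eq_left.2 (show Set.Ioc x (x + A) ⊆ Set.Ioi 0 from fun y hy => lt_trans hx hy.1)]
  have : ENNReal.ofReal (c * (σ * x / Ms) * Real.exp (-(σ * (x + A) / m))) * ENNReal.ofReal (q - p)
      * ENNReal.ofReal A = ∫⁻ y in Set.Ioc x (x + A), ∫⁻ u in Set.Ioc p q,
        ENNReal.ofReal (c * (σ * x / Ms) * Real.exp (-(σ * (x + A) / m))) := by
    simp
  rw [this]
  refine setLIntegral_mono' measurableSet_Ioc fun y hy => ?_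
  unfold kd
  refine le_trans ?_ (lintegral_mono_set (Set.Ioc_subset_Ioc hp hq))
  refine setLIntegral_mono' measurableSet_Ioc fun u hu => ?_
  obtain ⟨h1, h2⟩ := hM u hu
  have hMu : 0 < M u := by linarith
  have hu0 : 0 < u := lt_of_le_of_lt hp hu.1
  have hy0 : 0 < y := lt_trans hx hy.1
  have hA : 0 < x + A := lt_of_lt_of_le hy0 hy.2
  refine ENNReal.ofReal_le_ofReal ?_
  have i1 : c ≤ c / u := by
    rw [le_div_iff₀ hu0]; nlinarith [hu.2]
  have i2 : σ * x / Ms ≤ σ * y / M u := by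
    have := hy.1.le
    gcongr
  have i3 : σ * y / M u ≤ σ * (x + A) / m := by
    have := hy.2
    gcongr
  have : 0 ≤ σ * x / Ms := by positivity
  gcongr

lemma final_limit (f : ℝ → ℝ) (τ : ℝ) (hτ : 0 < τ)
    (hup : ∀ t, 0 < t → t < τ → ∃ B : ℝ, 0 < B ∧ ∀ x : ℝ, f x ≤ B * Real.exp (-(t * x)))
    (hlo : ∀ r, τ < r → ∃ D : ℝ, 0 < D ∧ ∀ᶠ x : ℝ in atTop, D * Real.exp (-(r * x)) ≤ f x) :
    Tendsto (fun x : ℝ => Real.log (f x) / x) atTop (𝓝 (-τ)) := by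
  have hpos : ∀ᶠ x : ℝ in atTop, 0 < f x := by
    obtain ⟨D, hD, h⟩ := hlo (τ + 1) (by linarith)
    filter_upwards [h] with x hx
    exact lt_of_lt_of_le (by positivity) hx
  have hlim : ∀ K t : ℝ, Tendsto (fun x : ℝ => K / x - t) atTop (𝓝 (-t)) := by
    intro K t
    simpa using (tendsto_const_nhds.div_atTop tendsto_id : Tendsto (fun x : ℝ => K / x) atTop (𝓝 0)).sub_const t
  rw [tendsto_order]
  constructor
  · intro a ha
    obtain ⟨r, hr1, hr2⟩ := exists_between (show τ < -a by linarith)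
    obtain ⟨D, hD, h⟩ := hlo r hr1
    filter_upwards [h, (hlim (Real.log D) r).eventually (lt_mem_nhds (show a < -r by linarith)),
      eventually_gt_atTop 0] with x hx h1 hx0
    refine lt_of_lt_of_le h1 ?_
    have := Real.log_le_log (by positivity) hx
    rw [Real.log_mul hD.ne' (Real.exp_pos _).ne', Real.log_exp] at this
    rw [le_div_iff₀ hx0]
    have e : (Real.log D / x - r) * x = Real.log D + -(r * x) := by field_simp; ring
    rw [e]; exact this
  · intro a ha
    obtain ⟨t, ht1, ht2⟩ := exists_between (show max 0 (-a) < τ from max_lt hτ (by linarith))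
    have ht0 : 0 < t := lt_of_le_of_lt (le_max_left _ _) ht1
    have hta : -a < t := lt_of_le_of_lt (le_max_right _ _) ht1
    obtain ⟨B, hB, h⟩ := hup t ht0 ht2
    filter_upwards [hpos, (hlim (Real.log B) t).eventually (gt_mem_nhds (show -t < a by linarith)),
      eventually_gt_atTop 0] with x hx h1 hx0
    refine lt_of_le_of_lt ?_ h1
    have := Real.log_le_log hx (h x)
    rw [Real.log_mul hB.ne' (Real.exp_pos _).ne', Real.log_exp] at this
    rw [div_le_iff₀ hx0]
    have e : (Real.log B / x - t) * x = Real.log B + -(t * x) := by field_simp; ring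
    rw [e]; exact this

/-- **Exponential rainfall gives exponential tail decay of the invariant outlet
discharge.** If `P_1 ~ Exp(σ)`, `M_r` is continuous on `[0,1]` with maximum
`M* > 0` attained at an interior point `u*` where `M_r` is differentiable, then
`lim_{x→∞} (1/x)·log g_r((x,∞)) = −σ/M*`. -/
theorem invariant_tail_exponential
    (lam Hr : ℝ) (hlam : 0 < lam) (hHr : 0 < Hr)
    (Mr : ℝ → ℝ) (hMr_meas : Measurable Mr)
    (hMr_nonneg : ∀ u ∈ Set.Icc (0:ℝ) 1, 0 ≤ Mr u)
    (hMr_int : IntegrableOn (fun u => Mr u / u) (Set.Ioc (0:ℝ) 1))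
    (σ : ℝ) (hσ : 0 < σ)
    (μP : Measure ℝ) (hμP : μP = ProbabilityTheory.expMeasure σ)
    (hMr_cont : ContinuousOn Mr (Set.Icc (0:ℝ) 1))
    (Mstar ustar : ℝ) (hustar : ustar ∈ Set.Ioo (0:ℝ) 1)
    (hmax_attained : Mr ustar = Mstar)
    (hmax : ∀ u ∈ Set.Icc (0:ℝ) 1, Mr u ≤ Mstar)
    (hMstar_pos : 0 < Mstar)
    (hdiff : DifferentiableAt ℝ Mr ustar)
    (gr : Measure ℝ) [IsProbabilityMeasure gr] (hgr : gr (Set.Ici (0:ℝ)) = 1)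
    (hgrLaplace : ∀ s : ℝ, 0 ≤ s →
      ∫ x, Real.exp (-(s * x)) ∂gr
        = Real.exp (-(lam / Hr * ∫ u in Set.Ioc (0:ℝ) 1,
            (1 - ∫ y, Real.exp (-(Mr u * s * y)) ∂μP) / u))) :
    Tendsto (fun x : ℝ => Real.log ((gr (Set.Ioi x)).toReal) / x) atTop
      (𝓝 (-(σ / Mstar))) := by
  subst hμP
  have hg : ∀ᵐ x ∂gr, 0 ≤ x := by
    have := (prob_compl_eq_zero_iff (μ := gr) (measurableSet_Ici (a := (0:ℝ)))).2 hgr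
    rw [ae_iff]
    exact this
  set c := lam / Hr with hc_def
  have hc : 0 < c := div_pos hlam hHr
  have hid := steutel c σ hc hσ Mr hMr_meas hMr_nonneg hMr_int gr hg hgrLaplace
  have : SFinite (kM c σ Mr) := by unfold kM; infer_instance
  have hk : ∀ᵐ y ∂(kM c σ Mr), 0 ≤ y := by
    unfold kM
    refine (withDensity_absolutelyContinuous _ _).ae_le ?_
    filter_upwards [ae_restrict_mem measurableSet_Ioi] with y hy
    exact le_of_lt hy
  refine final_limit (fun x => (gr (Set.Ioi x)).toReal) (σ / Mstar) (by positivity) ?_ ?_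
  · intro t ht htτ
    rw [lt_div_iff₀ hMstar_pos] at htτ
    refine upper_tail gr (kM c σ Mr) hk hid t ht ?_
    have hge : ∀ u ∈ Set.Icc (0:ℝ) 1, σ - t * Mstar ≤ σ + Mr u * (-t) := by
      intro u hu
      nlinarith [hmax u hu]
    have hl := kM_laplace c σ hc hσ Mr hMr_meas hMr_nonneg (-t)
      (fun u hu => lt_of_lt_of_le (by linarith) (hge u hu))
    simp only [neg_mul, neg_neg] at hl
    rw [hl]
    refine ne_top_of_le_ne_top (hMr_int.const_mul (c * σ / (σ - t * Mstar) ^ 2)).lintegral_lt_top.ne ?_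
    refine setLIntegral_mono' measurableSet_Ioc fun u hu => ENNReal.ofReal_le_ofReal ?_
    have huI : u ∈ Set.Icc (0:ℝ) 1 := ⟨hu.1.le, hu.2⟩
    have h1 := hge u huI
    have h2 := hMr_nonneg u huI
    have h3 := hu.1
    have h4 : 0 < σ - t * Mstar := by linarith
    have e : c * σ / (σ - t * Mstar) ^ 2 * (Mr u / u)
        = c * (σ * (Mr u / u) / (σ - t * Mstar) ^ 2) := by ring
    rw [e]
    gcongr
  · intro r hr
    have hr0 : 0 < r := lt_trans (by positivity) hr
    rw [div_lt_iff₀ hMstar_pos] at hr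
    have hm : σ / r < Mr ustar := by
      rw [hmax_attained, div_lt_iff₀ hr0]; linarith
    have hnb : {u | σ / r < Mr u} ∩ Set.Ioo 0 1 ∈ 𝓝 ustar :=
      inter_mem (hdiff.continuousAt.eventually (lt_mem_nhds hm)) (Ioo_mem_nhds hustar.1 hustar.2)
    obtain ⟨l, q', hlq, hsub⟩ := mem_nhds_iff_exists_Ioo_subset.1 hnb
    obtain ⟨q, hq1, hq2⟩ := exists_between hlq.2
    have hin : ∀ u ∈ Set.Ioc ustar q, u ∈ {u | σ / r < Mr u} ∩ Set.Ioo 0 1 := fun u hu =>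
      hsub ⟨lt_trans hlq.1 hu.1, lt_of_le_of_lt hu.2 hq2⟩
    have hqq := (hin q ⟨hq1, le_rfl⟩).2
    obtain ⟨n, hn⟩ : ∃ n : ℕ, gr (Set.Icc 0 (n:ℝ)) ≠ 0 := by
      by_contra! hcon
      have h0 := measure_iUnion_null hcon
      have hU : Set.Ici (0:ℝ) ⊆ ⋃ n : ℕ, Set.Icc 0 (n:ℝ) := by
        intro x hx
        obtain ⟨n, hn⟩ := exists_nat_ge x
        exact Set.mem_iUnion.2 ⟨n, hx, hn⟩
      have := measure_mono_null hU h0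
      rw [hgr] at this
      exact one_ne_zero this
    set A : ℝ := n + 1 with hA
    have hA0 : 0 < A := by positivity
    have hγ : 0 < (gr (Set.Icc 0 A)).toReal := by
      refine ENNReal.toReal_pos (fun h => hn ?_) (measure_ne_top _ _)
      exact measure_mono_null (Set.Icc_subset_Icc_right (by linarith)) h
    set γ := (gr (Set.Icc 0 A)).toReal with hγdef
    have hqp : 0 < q - ustar := by linarith
    refine ⟨γ * (c * (σ / Mstar) * Real.exp (-(r * A)) * (q - ustar) * A) / 2, by positivity, ?_⟩
    filter_upwards [eventually_ge_atTop (2 * A)] with x hx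
    have hx0 : 0 < x := by linarith
    have k1 := kM_lower c σ hc hσ Mr (σ / r) Mstar ustar q (by positivity) hustar.1.le hqq.2.le
      (fun u hu => ⟨(hin u hu).1.le, hmax u ⟨(hin u hu).2.1.le, (hin u hu).2.2.le⟩⟩) x A hx0 hMstar_pos
    have k2 := (mul_le_mul_right k1 (gr (Set.Icc 0 A))).trans (lower_tail gr (kM c σ Mr) hid A x)
    have k3 := ENNReal.toReal_mono
      (ENNReal.mul_ne_top ENNReal.ofReal_ne_top (measure_ne_top _ _)) k2
    rw [ENNReal.toReal_mul, ENNReal.toReal_mul, ENNReal.toReal_mul, ENNReal.toReal_mul,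
      ENNReal.toReal_ofReal (by positivity), ENNReal.toReal_ofReal hqp.le,
      ENNReal.toReal_ofReal hA0.le, ENNReal.toReal_ofReal (by positivity)] at k3
    have e : -(σ * (x + A) / (σ / r)) = -(r * A) + -(r * x) := by
      field_simp; ring
    rw [e, Real.exp_add] at k3
    set f := (gr (Set.Ioi x)).toReal with hf
    have hf0 : 0 ≤ f := ENNReal.toReal_nonneg
    have k4 : (x + 2 * A) * f ≤ (2 * x) * f := by gcongr; linarith
    have k5 := k3.trans k4
    refine le_of_mul_le_mul_left ?_ (show 0 < 2 * x by linarith)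
    refine le_trans (le_of_eq ?_) k5
    rw [← hγdef]
    ring

end
end
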